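/- arXiv:2408.00130 — 5 statements merged into one kernel-verified Lean document; each statement's English description precedes it below -/
import Mathlib

section
/- Let D ≥ 1, ε > 0, and let Γ ∈ ℝ^{D×D} be real symmetric positive definite. If ψ₀ : ℝ^D → ℂ is a Schwartz function, then the FBI-type transform Tψ₀ : ℝ^{2D} → ℂ defined by (Tψ₀)(z) = (2πε)^{-D/2} ∫_{ℝ^D} conj(g_z(x)) ψ₀(x) dx is a Schwartz function on ℝ^{2D}; consequently the function f₀ : ℝ^{2D} × ℝ^{2D} → ℂ defined by f₀(y,z) = (2πε)^{-2D} (∫_{ℝ^D} conj(ψ₀(x)) g_y(x) dx) · (∫_{ℝ^D} conj(g_z(x)) ψ₀(x) dx) is a Schwartz function on ℝ^{2D} × ℝ^{2D}. -/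
open MeasureTheory Matrix

/-- The Gaussian wavepacket with width matrix `Γ`, semiclassical parameter `ε`,
centered at the phase-space point `z = (q, p)`. -/
noncomputable def gaussian {D : ℕ} (ε : ℝ) (Γ : Matrix (Fin D) (Fin D) ℝ)
    (z : (Fin D → ℝ) × (Fin D → ℝ)) (x : Fin D → ℝ) : ℂ :=
  (((Γ.det / (Real.pi ^ D * ε ^ D)) ^ ((1 : ℝ) / 4) : ℝ) : ℂ) *
    Complex.exp ((↑(-(1 / (2 * ε)) * ((x - z.1) ⬝ᵥ Γ.mulVec (x - z.1))) : ℂ) +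
      Complex.I * (↑((1 / ε) * (z.2 ⬝ᵥ (x - z.1))) : ℂ))

open scoped SchwartzMap Nat ContDiff FourierTransform RealInnerProductSpace

theorem norm_iteratedFDeriv_cexp_mul_ofReal (a : ℂ) (n : ℕ) (t : ℝ) :
    ‖iteratedFDeriv ℝ n (fun s : ℝ ↦ Complex.exp (a * s)) t‖ =
      ‖a‖ ^ n * Real.exp (a.re * t) := by
  have h : iteratedDeriv n (fun s : ℝ ↦ Complex.exp (a * s)) =
      fun s : ℝ ↦ a ^ n * Complex.exp (a * s) := by
    induction n with
    | zero => simp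
    | succ n ih =>
      rw [iteratedDeriv_succ, ih]
      funext s
      have h₁ : HasDerivAt (fun s : ℝ ↦ a * (s : ℂ)) a s := by
        simpa using Complex.ofRealCLM.hasDerivAt.const_mul a
      rw [(h₁.cexp.const_mul (a ^ n)).deriv]
      ring
  rw [norm_iteratedFDeriv_eq_norm_iteratedDeriv, h]
  simp [Complex.norm_exp]

theorem contDiff_cexp_mul_ofReal (a : ℂ) :
    ContDiff ℝ ∞ (fun s : ℝ ↦ Complex.exp (a * s)) := by
  have := Complex.ofRealCLM.contDiff (n := ∞)
  exact (contDiff_const.mul this).cexp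

theorem hasTemperateGrowth_cexp_I_mul (b : ℝ) :
    Function.HasTemperateGrowth (fun s : ℝ ↦ Complex.exp (b * Complex.I * s)) := by
  refine ⟨contDiff_cexp_mul_ofReal _, fun n ↦ ⟨0, ‖(b * Complex.I : ℂ)‖ ^ n, fun x ↦ ?_⟩⟩
  rw [norm_iteratedFDeriv_cexp_mul_ofReal]
  simp

theorem one_add_pow_mul_exp_neg_mul_sq_le {c : ℝ} (hc : 0 < c) (m : ℕ) {r : ℝ} (hr : 0 ≤ r) :
    (1 + r) ^ m * Real.exp (-(c * r ^ 2)) ≤ m ! * Real.exp (1 + 1 / (4 * c)) := by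
  have h₁ : -(c * r ^ 2) ≤ (1 + 1 / (4 * c)) + -(1 + r) := by
    have : 0 ≤ c * (r - 1 / (2 * c)) ^ 2 := by positivity
    have e : c * (r - 1 / (2 * c)) ^ 2 = c * r ^ 2 - r + 1 / (4 * c) := by field_simp; ring
    linarith
  have h₂ : (1 + r) ^ m ≤ m ! * Real.exp (1 + r) := by
    have := Real.pow_div_factorial_le_exp (1 + r) (by positivity) m
    rwa [div_le_iff₀' (by positivity)] at this
  calc
    _ ≤ (m ! * Real.exp (1 + r)) * Real.exp ((1 + 1 / (4 * c)) + -(1 + r)) := by gcongr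
    _ = m ! * Real.exp (1 + 1 / (4 * c)) := by
      rw [mul_assoc, ← Real.exp_add]
      congr 2
      ring

theorem exists_schwartzMap_eq_cexp_neg {E : Type*} [NormedAddCommGroup E] [NormedSpace ℝ E]
    {Q : E → ℝ} (hQ : Q.HasTemperateGrowth) {c : ℝ} (hc : 0 < c) (hcQ : ∀ x, c * ‖x‖ ^ 2 ≤ Q x) :
    ∃ G : 𝓢(E, ℂ), ∀ x, G x = Complex.exp (-1 * (Q x : ℂ)) := by
  refine ⟨⟨fun x ↦ Complex.exp (-1 * (Q x : ℂ)), (contDiff_cexp_mul_ofReal (-1)).comp hQ.1,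
    fun k n ↦ ?_⟩, fun x ↦ rfl⟩
  obtain ⟨l, C, hC, hgrowth⟩ := hQ.norm_iteratedFDeriv_le_uniform n
  refine ⟨n ! * (C + 1) ^ n * ((k + l * n)! * Real.exp (1 + 1 / (4 * c))), fun x ↦ ?_⟩
  have hgrowth' (N : ℕ) (hN₁ : 1 ≤ N) (hN₂ : N ≤ n) :
      ‖iteratedFDeriv ℝ N Q x‖ ≤ ((C + 1) * (1 + ‖x‖) ^ l) ^ N := by
    refine (hgrowth N hN₂ x).trans ?_
    rw [mul_pow]
    have hN₁' := (lt_of_lt_of_le zero_lt_one hN₁).ne'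
    gcongr
    · exact le_trans (by simp) (le_self_pow₀ (by simp [hC]) hN₁')
    · exact le_self_pow₀ (one_le_pow₀ (by simp)) hN₁'
  have h := norm_iteratedFDeriv_comp_le (contDiff_cexp_mul_ofReal (-1)) hQ.1 (mod_cast le_top) x
    (C := Real.exp (-(c * ‖x‖ ^ 2))) (n := n)
    (fun i _ ↦ by
      rw [norm_iteratedFDeriv_cexp_mul_ofReal]
      simpa using hcQ x) hgrowth'
  change ‖x‖ ^ k * ‖iteratedFDeriv ℝ n ((fun s : ℝ ↦ Complex.exp (-1 * s)) ∘ Q) x‖ ≤ _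
  calc
    _ ≤ (1 + ‖x‖) ^ k *
        (n ! * Real.exp (-(c * ‖x‖ ^ 2)) * ((C + 1) * (1 + ‖x‖) ^ l) ^ n) := by
      gcongr
      linarith
    _ = n ! * (C + 1) ^ n * ((1 + ‖x‖) ^ (k + l * n) * Real.exp (-(c * ‖x‖ ^ 2))) := by
      rw [mul_pow, ← pow_mul, pow_add]
      ring
    _ ≤ _ := by
      refine mul_le_mul_of_nonneg_left ?_ (by positivity)
      exact one_add_pow_mul_exp_neg_mul_sq_le hc _ (norm_nonneg x)

theorem exists_schwartzMap_eq_mul {E F : Type*} [NormedAddCommGroup E] [NormedSpace ℝ E]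
    [NormedAddCommGroup F] [NormedSpace ℝ F] (f : 𝓢(E, ℂ)) (g : 𝓢(F, ℂ)) :
    ∃ H : 𝓢(E × F, ℂ), ∀ z, H z = f z.1 * g z.2 := by
  have hf : ContDiff ℝ ∞ (fun z : E × F ↦ f z.1) := (f.smooth ⊤).comp contDiff_fst
  have hg : ContDiff ℝ ∞ (fun z : E × F ↦ g z.2) := (g.smooth ⊤).comp contDiff_snd
  have hf' (i : ℕ) (z : E × F) :
      ‖iteratedFDeriv ℝ i (fun z : E × F ↦ f z.1) z‖ ≤ ‖iteratedFDeriv ℝ i f z.1‖ := by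
    have h := (ContinuousLinearMap.fst ℝ E F).iteratedFDeriv_comp_right (f.smooth ⊤) z
      (i := i) (mod_cast le_top)
    change ‖iteratedFDeriv ℝ i (f ∘ ContinuousLinearMap.fst ℝ E F) z‖ ≤ _
    rw [h]
    refine (ContinuousMultilinearMap.norm_compContinuousLinearMap_le _ _).trans ?_
    refine mul_le_of_le_one_right (norm_nonneg _) ?_
    exact Finset.prod_le_one (fun _ _ ↦ norm_nonneg _)
      fun _ _ ↦ ContinuousLinearMap.norm_fst_le ℝ E F
  have hg' (i : ℕ) (z : E × F) :
      ‖iteratedFDeriv ℝ i (fun z : E × F ↦ g z.2) z‖ ≤ ‖iteratedFDeriv ℝ i g z.2‖ := by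
    have h := (ContinuousLinearMap.snd ℝ E F).iteratedFDeriv_comp_right (g.smooth ⊤) z
      (i := i) (mod_cast le_top)
    change ‖iteratedFDeriv ℝ i (g ∘ ContinuousLinearMap.snd ℝ E F) z‖ ≤ _
    rw [h]
    refine (ContinuousMultilinearMap.norm_compContinuousLinearMap_le _ _).trans ?_
    refine mul_le_of_le_one_right (norm_nonneg _) ?_
    exact Finset.prod_le_one (fun _ _ ↦ norm_nonneg _)
      fun _ _ ↦ ContinuousLinearMap.norm_snd_le ℝ E F
  refine ⟨⟨fun z ↦ f z.1 * g z.2, hf.mul hg, fun k n ↦ ?_⟩, fun z ↦ rfl⟩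
  let S (m i : ℕ) : ℝ := SchwartzMap.seminorm ℝ m i f
  let S' (m i : ℕ) : ℝ := SchwartzMap.seminorm ℝ m i g
  refine ⟨∑ i ∈ Finset.range (n + 1), (n.choose i : ℝ) *
    (S k i * S' 0 (n - i) + S 0 i * S' k (n - i)), fun z ↦ ?_⟩
  have h := norm_iteratedFDeriv_mul_le hf hg z (n := n) (mod_cast le_top)
  grw [h, Finset.mul_sum]
  refine Finset.sum_le_sum fun i _ ↦ ?_
  have hz : ‖z‖ ^ k ≤ ‖z.1‖ ^ k + ‖z.2‖ ^ k := by
    rcases max_choice ‖z.1‖ ‖z.2‖ with h | h <;> rw [Prod.norm_def, h]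
    · exact le_add_of_nonneg_right (by positivity)
    · exact le_add_of_nonneg_left (by positivity)
  calc
    _ ≤ (‖z.1‖ ^ k + ‖z.2‖ ^ k) *
        (n.choose i * ‖iteratedFDeriv ℝ i f z.1‖ * ‖iteratedFDeriv ℝ (n - i) g z.2‖) := by
      gcongr
      · exact hf' i z
      · exact hg' (n - i) z
    _ = n.choose i *
        ((‖z.1‖ ^ k * ‖iteratedFDeriv ℝ i f z.1‖) * ‖iteratedFDeriv ℝ (n - i) g z.2‖ +
          ‖iteratedFDeriv ℝ i f z.1‖ * (‖z.2‖ ^ k * ‖iteratedFDeriv ℝ (n - i) g z.2‖)) := by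
      ring
    _ ≤ _ := by
      gcongr
      · exact f.le_seminorm ℝ k i z.1
      · exact g.norm_iteratedFDeriv_le_seminorm ℝ (n - i) z.2
      · exact f.norm_iteratedFDeriv_le_seminorm ℝ i z.1
      · exact g.le_seminorm ℝ k (n - i) z.2

theorem Matrix.PosDef.exists_pos_mul_sq_norm_le {n : Type*} [Fintype n] {Γ : Matrix n n ℝ}
    (hΓ : Γ.PosDef) : ∃ c : ℝ, 0 < c ∧ ∀ x : n → ℝ, c * ‖x‖ ^ 2 ≤ x ⬝ᵥ Γ.mulVec x := by
  have hcont : Continuous fun x : n → ℝ ↦ x ⬝ᵥ Γ.mulVec x := by fun_prop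
  have hpos {x : n → ℝ} (hx : x ≠ 0) : 0 < x ⬝ᵥ Γ.mulVec x := by
    simpa using hΓ.dotProduct_mulVec_pos hx
  rcases (Metric.sphere (0 : n → ℝ) 1).eq_empty_or_nonempty with he | hne
  · refine ⟨1, one_pos, fun x ↦ ?_⟩
    by_cases hx : x = 0
    · simp [hx]
    · have : ‖x‖⁻¹ • x ∈ Metric.sphere (0 : n → ℝ) 1 := by
        simp [norm_smul, hx]
      simp [he] at this
  · obtain ⟨y, hy, hmin⟩ := (isCompact_sphere (0 : n → ℝ) 1).exists_isMinOn hne hcont.continuousOn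
    have hy₀ : y ≠ 0 := by
      rintro rfl
      simp at hy
    refine ⟨_, hpos hy₀, fun x ↦ ?_⟩
    by_cases hx : x = 0
    · simp [hx]
    have hx' : 0 < ‖x‖ := norm_pos_iff.2 hx
    have hmem : ‖x‖⁻¹ • x ∈ Metric.sphere (0 : n → ℝ) 1 := by simp [norm_smul, hx]
    have h := isMinOn_iff.1 hmin _ hmem
    simp only [mulVec_smul, dotProduct_smul, smul_dotProduct, smul_eq_mul] at h
    calc
      _ ≤ (‖x‖⁻¹ * (‖x‖⁻¹ * (x ⬝ᵥ Γ.mulVec x))) * ‖x‖ ^ 2 := by gcongr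
      _ = _ := by field_simp

theorem hasTemperateGrowth_dotProduct_mulVec {n : Type*} [Fintype n] (Γ : Matrix n n ℝ) :
    Function.HasTemperateGrowth (fun x : n → ℝ ↦ x ⬝ᵥ Γ.mulVec x) := by
  have h (i : n) : Function.HasTemperateGrowth (fun x : n → ℝ ↦ x i) :=
    (ContinuousLinearMap.proj i : (n → ℝ) →L[ℝ] ℝ).hasTemperateGrowth
  exact .sum fun i _ ↦ (h i).mul (.sum fun j _ ↦
    (Function.HasTemperateGrowth.const (Γ i j)).mul (h j))

theorem exists_schwartzMap_eq_cexp_quadratic {n : Type*} [Fintype n] {Γ : Matrix n n ℝ}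
    (hΓ : Γ.PosDef) {a : ℝ} (ha : 0 < a) :
    ∃ G : 𝓢(n → ℝ, ℂ), ∀ x, G x = Complex.exp (↑(-a * (x ⬝ᵥ Γ.mulVec x)) : ℂ) := by
  obtain ⟨c, hc, hcΓ⟩ := hΓ.exists_pos_mul_sq_norm_le
  obtain ⟨G, hG⟩ := exists_schwartzMap_eq_cexp_neg
    ((Function.HasTemperateGrowth.const a).mul (hasTemperateGrowth_dotProduct_mulVec Γ))
    (mul_pos ha hc) (fun x ↦ by
      rw [mul_assoc]
      exact mul_le_mul_of_nonneg_left (hcΓ x) ha.le)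
  exact ⟨G, fun x ↦ by rw [hG]; simp⟩

theorem exists_schwartzMap_eq_fourier_window {E : Type*} [NormedAddCommGroup E]
    [InnerProductSpace ℝ E] [FiniteDimensional ℝ E] [MeasurableSpace E] [BorelSpace E]
    (ψ G : 𝓢(E, ℂ)) :
    ∃ K : 𝓢(WithLp 2 (E × E), ℂ), ∀ q p : E, K (WithLp.toLp 2 (-q, p)) =
      ∫ u, Complex.exp (↑(-2 * Real.pi * ⟪u, p⟫) * Complex.I) * (G u * ψ (u + q)) := by
  obtain ⟨H, hH⟩ := exists_schwartzMap_eq_mul (𝓕 ψ) G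
  let e := WithLp.prodContinuousLinearEquiv 2 ℝ E E
  let chirp (w : WithLp 2 (E × E)) : ℂ :=
    Complex.exp ((2 * Real.pi : ℝ) * Complex.I * (⟪w.fst, w.snd⟫ : ℝ))
  have hchirp : chirp.HasTemperateGrowth := by
    have h₁ : Function.HasTemperateGrowth (fun w : WithLp 2 (E × E) ↦ w.fst) :=
      ((ContinuousLinearMap.fst ℝ E E).comp e.toContinuousLinearMap).hasTemperateGrowth
    have h₂ : Function.HasTemperateGrowth (fun w : WithLp 2 (E × E) ↦ w.snd) :=
      ((ContinuousLinearMap.snd ℝ E E).comp e.toContinuousLinearMap).hasTemperateGrowth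
    exact (hasTemperateGrowth_cexp_I_mul (2 * Real.pi)).comp
      ((innerSL ℝ (E := E)).bilinear_hasTemperateGrowth h₁ h₂)
  let A : 𝓢(WithLp 2 (E × E), ℂ) := SchwartzMap.smulLeftCLM ℂ chirp
    (SchwartzMap.compCLMOfContinuousLinearEquiv ℂ e H)
  have hA (x : E × E) : A (WithLp.toLp 2 x) =
      Complex.exp ((2 * Real.pi : ℝ) * Complex.I * (⟪x.1, x.2⟫ : ℝ)) * ((𝓕 ψ) x.1 * G x.2) := by
    rw [SchwartzMap.smulLeftCLM_apply_apply hchirp]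
    simp [chirp, e, hH]
  refine ⟨𝓕 A, fun q p ↦ ?_⟩
  have hint : Integrable fun v : WithLp 2 (E × E) ↦
      Complex.exp (↑(-2 * Real.pi * ⟪v, WithLp.toLp 2 (-q, p)⟫) * Complex.I) • A v := by
    have h := (Real.fourierIntegral_convergent_iff (μ := volume)
      (WithLp.toLp 2 (-q, p) : WithLp 2 (E × E))).2 A.integrable
    simpa only [Circle.smul_def, Real.fourierChar_apply, mul_neg, neg_mul] using h
  have hmp := WithLp.volume_preserving_toLp E E
  have hemb := (MeasurableEquiv.toLp 2 (E × E)).measurableEmbedding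
  rw [SchwartzMap.fourier_coe, Real.fourier_eq', ← hmp.integral_comp hemb]
  have hint' := (hmp.integrable_comp_emb hemb).2 hint
  rw [Measure.volume_eq_prod] at hint' ⊢
  refine (integral_prod_symm _ hint').trans ?_
  congr 1
  funext u
  have hψ : ψ (u + q) = ∫ ξ, Complex.exp (↑(2 * Real.pi * ⟪ξ, u + q⟫) * Complex.I) • (𝓕 ψ) ξ := by
    rw [← Real.fourierInv_eq', ← SchwartzMap.fourierInv_coe, FourierTransform.fourierInv_fourier_eq]
  rw [hψ, ← integral_const_mul, ← integral_const_mul]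
  congr 1
  funext ξ
  rw [Function.comp_apply, hA]
  simp only [smul_eq_mul, WithLp.prod_inner_apply, inner_neg_right, inner_add_right]
  have h : Complex.exp (↑(-2 * Real.pi * (-⟪ξ, q⟫ + ⟪u, p⟫)) * Complex.I) *
      Complex.exp ((2 * Real.pi : ℝ) * Complex.I * (⟪ξ, u⟫ : ℝ)) =
      Complex.exp (↑(-2 * Real.pi * ⟪u, p⟫) * Complex.I) *
      Complex.exp (↑(2 * Real.pi * (⟪ξ, u⟫ + ⟪ξ, q⟫)) * Complex.I) := by
    rw [← Complex.exp_add, ← Complex.exp_add]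
    congr 1
    push_cast
    ring
  linear_combination ((𝓕 ψ) ξ * G u) * h

theorem exists_schwartzMap_eq_integral_gaussian {D : ℕ} {ε : ℝ} (hε : 0 < ε)
    {Γ : Matrix (Fin D) (Fin D) ℝ} (hΓ : Γ.PosDef) (ψ : 𝓢(Fin D → ℝ, ℂ)) :
    ∃ S : 𝓢((Fin D → ℝ) × (Fin D → ℝ), ℂ), ∀ z,
      S z = ∫ x, (starRingEnd ℂ) (gaussian ε Γ z x) * ψ x := by
  obtain ⟨G, hG⟩ := exists_schwartzMap_eq_cexp_quadratic hΓ
    (show 0 < 1 / (2 * ε) by positivity)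
  let e := PiLp.continuousLinearEquiv 2 ℝ (fun _ : Fin D ↦ ℝ)
  obtain ⟨K, hK⟩ := exists_schwartzMap_eq_fourier_window
    (SchwartzMap.compCLMOfContinuousLinearEquiv ℂ e ψ)
    (SchwartzMap.compCLMOfContinuousLinearEquiv ℂ e G)
  have hs : (2 * Real.pi * ε)⁻¹ ≠ 0 := by positivity
  let L := (((ContinuousLinearEquiv.neg ℝ).trans e.symm).prodCongr
    ((ContinuousLinearEquiv.smulLeft (Units.mk0 _ hs)).trans e.symm)).trans
      (WithLp.prodContinuousLinearEquiv 2 ℝ _ _).symm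
  let c : ℂ := (((Γ.det / (Real.pi ^ D * ε ^ D)) ^ ((1 : ℝ) / 4) : ℝ) : ℂ)
  refine ⟨c • SchwartzMap.compCLMOfContinuousLinearEquiv ℂ L K, fun z ↦ ?_⟩
  obtain ⟨q, p⟩ := z
  have hL : L (q, p) = WithLp.toLp 2
      (-WithLp.toLp 2 q, WithLp.toLp 2 ((2 * Real.pi * ε)⁻¹ • p)) := rfl
  rw [_root_.smul_apply, SchwartzMap.compCLMOfContinuousLinearEquiv_apply,
    Function.comp_apply, hL, hK, ← (PiLp.volume_preserving_toLp (Fin D)).integral_comp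
      (MeasurableEquiv.toLp 2 (Fin D → ℝ)).measurableEmbedding,
    ← integral_add_right_eq_self (fun x ↦ (starRingEnd ℂ) (gaussian ε Γ (q, p) x) * ψ x) q,
    smul_eq_mul, ← integral_const_mul]
  congr 1
  funext u
  have h : (starRingEnd ℂ) (gaussian ε Γ (q, p) (u + q)) =
      c * (G u * Complex.exp (-(Complex.I * (↑((1 / ε) * (p ⬝ᵥ u)) : ℂ)))) := by
    rw [hG, ← Complex.exp_add]
    simp [gaussian, c, ← Complex.exp_conj, map_ofNat]
  rw [h]
  have h' : Complex.exp (↑(-2 * Real.pi *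
      ⟪(WithLp.toLp 2 u : EuclideanSpace ℝ (Fin D)),
        WithLp.toLp 2 ((2 * Real.pi * ε)⁻¹ • p)⟫) * Complex.I) =
      Complex.exp (-(Complex.I * (↑((1 / ε) * (p ⬝ᵥ u)) : ℂ))) := by
    rw [mul_comm _ Complex.I, ← mul_neg, ← Complex.ofReal_neg]
    congr 3
    rw [EuclideanSpace.inner_toLp_toLp, smul_dotProduct, star_trivial, smul_eq_mul]
    field_simp
  rw [h']
  have he (v : Fin D → ℝ) : e (WithLp.toLp 2 v) = v := rfl
  simp only [SchwartzMap.compCLMOfContinuousLinearEquiv_apply, Function.comp_apply,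
    ← WithLp.toLp_add, he]
  ring

theorem stmt0 (D : ℕ) (hD : 1 ≤ D) (ε : ℝ) (hε : 0 < ε)
    (Γ : Matrix (Fin D) (Fin D) ℝ) (hΓ : Γ.PosDef)
    (ψ₀ : SchwartzMap (Fin D → ℝ) ℂ) :
    (∃ T : SchwartzMap ((Fin D → ℝ) × (Fin D → ℝ)) ℂ,
      ∀ z : (Fin D → ℝ) × (Fin D → ℝ),
        T z = (((2 * Real.pi * ε) ^ (-(D : ℝ) / 2) : ℝ) : ℂ) *
          ∫ x : Fin D → ℝ, (starRingEnd ℂ) (gaussian ε Γ z x) * ψ₀ x) ∧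
    (∃ F : SchwartzMap (((Fin D → ℝ) × (Fin D → ℝ)) × ((Fin D → ℝ) × (Fin D → ℝ))) ℂ,
      ∀ y z : (Fin D → ℝ) × (Fin D → ℝ),
        F (y, z) = (((((2 * Real.pi * ε) ^ (2 * D))⁻¹ : ℝ)) : ℂ) *
          (∫ x : Fin D → ℝ, (starRingEnd ℂ) (ψ₀ x) * gaussian ε Γ y x) *
          (∫ x : Fin D → ℝ, (starRingEnd ℂ) (gaussian ε Γ z x) * ψ₀ x)) := by
  obtain ⟨S, hS⟩ := exists_schwartzMap_eq_integral_gaussian hε hΓ ψ₀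
  obtain ⟨F, hF⟩ := exists_schwartzMap_eq_mul
    (SchwartzMap.postcompCLM (𝕜 := ℝ) Complex.conjCLE.toContinuousLinearMap S) S
  refine ⟨⟨(((2 * Real.pi * ε) ^ (-(D : ℝ) / 2) : ℝ) : ℂ) • S, fun z ↦ by simp [hS]⟩,
    ⟨(((((2 * Real.pi * ε) ^ (2 * D))⁻¹ : ℝ)) : ℂ) • F, fun y z ↦ ?_⟩⟩
  have h : ∫ x, (starRingEnd ℂ) (ψ₀ x) * gaussian ε Γ y x = (starRingEnd ℂ) (S y) := by
    rw [hS, ← integral_conj]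
    simp [mul_comm]
  rw [h, ← hS, mul_assoc]
  simp [hF, mul_assoc]
end

section
/- (Squared-position matrix element between Gaussian wavepackets.) Let D ≥ 1, ε > 0, Γ ∈ ℝ^{D×D} real symmetric positive definite, and j ∈ {1,…,D}. For all phase-space points y = (q_y, p_y) and z = (q_z, p_z) in ℝ^D × ℝ^D, the integral ∫_{ℝ^D} conj(g_y(x)) x_j² g_z(x) dx exists and equals (1/4)[ 2ε(Γ⁻¹)_{jj} + ((q_y + q_z − iΓ⁻¹p_y + iΓ⁻¹p_z)_j)² ] · ⟨g_y, g_z⟩, where (Γ⁻¹)_{jj} is the j-th diagonal entry of Γ⁻¹, (·)_j denotes the j-th component of the (complex) vector, and ⟨g_y, g_z⟩ = ∫_{ℝ^D} conj(g_y(x)) g_z(x) dx. -/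
open MeasureTheory Matrix

/-- Completing the square for a positive definite matrix along the direction `Γ⁻¹ eⱼ`. -/
lemma quadraticForm_add_smul_inv_col {D : ℕ} {Γ : Matrix (Fin D) (Fin D) ℝ} (hΓ : Γ.PosDef)
    (j : Fin D) (x : Fin D → ℝ) (t : ℝ) :
    (x + t • Γ⁻¹.col j) ⬝ᵥ Γ.mulVec (x + t • Γ⁻¹.col j) =
      x ⬝ᵥ Γ.mulVec x + 2 * t * x j + t ^ 2 * Γ⁻¹ j j := by
  have hdet : IsUnit Γ.det := hΓ.det_pos.ne'.isUnit
  have hsymm : Γᵀ = Γ := by simpa using hΓ.isHermitian.eq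
  have hcol : Γ.mulVec (Γ⁻¹.col j) = Pi.single j 1 := by
    rw [← mulVec_single_one, mulVec_mulVec, mul_nonsing_inv _ hdet, one_mulVec]
  have hcross : Γ⁻¹.col j ⬝ᵥ Γ.mulVec x = x j := by
    rw [dotProduct_mulVec, ← mulVec_transpose, hsymm, hcol, single_one_dotProduct]
  simp only [mulVec_add, mulVec_smul, add_dotProduct, dotProduct_add, smul_dotProduct,
    dotProduct_smul, hcol, hcross, dotProduct_single_one, smul_eq_mul, Pi.add_apply,
    Pi.smul_apply, col_apply]
  ring

lemma sq_apply_div_inv_diag_le {D : ℕ} {Γ : Matrix (Fin D) (Fin D) ℝ} (hΓ : Γ.PosDef)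
    (i : Fin D) (x : Fin D → ℝ) :
    x i ^ 2 / Γ⁻¹ i i ≤ x ⬝ᵥ Γ.mulVec x := by
  have hpos : 0 < Γ⁻¹ i i := hΓ.inv.diag_pos
  have h := quadraticForm_add_smul_inv_col hΓ i x (-(x i / Γ⁻¹ i i))
  have h0 := hΓ.posSemidef.dotProduct_mulVec_nonneg (x + (-(x i / Γ⁻¹ i i)) • Γ⁻¹.col i)
  rw [star_trivial, h] at h0
  have : 2 * -(x i / Γ⁻¹ i i) * x i + (-(x i / Γ⁻¹ i i)) ^ 2 * Γ⁻¹ i i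
      = -(x i ^ 2 / Γ⁻¹ i i) := by
    field_simp
    ring
  linarith

lemma sum_sq_div_inv_diag_le {D : ℕ} {Γ : Matrix (Fin D) (Fin D) ℝ} (hΓ : Γ.PosDef)
    (x : Fin D → ℝ) :
    ∑ i, x i ^ 2 / Γ⁻¹ i i ≤ D * (x ⬝ᵥ Γ.mulVec x) := by
  simpa using Finset.sum_le_sum fun i (_ : i ∈ Finset.univ) => sq_apply_div_inv_diag_le hΓ i x

lemma integrable_one_add_sq_mul_exp_neg_mul_sub_sq {b : ℝ} (hb : 0 < b) (a : ℝ) :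
    Integrable fun t : ℝ => (1 + t ^ 2) * Real.exp (-b * (t - a) ^ 2) := by
  have h0 := integrable_exp_neg_mul_sq hb
  have h1 := integrable_mul_exp_neg_mul_sq hb
  have h2 : Integrable fun t : ℝ => t ^ 2 * Real.exp (-b * t ^ 2) := by
    simpa using integrable_rpow_mul_exp_neg_mul_sq hb (s := 2) (by norm_num)
  have h := ((h0.const_mul (1 + a ^ 2)).add (h1.const_mul (2 * a))).add h2
  refine (h.comp_sub_right a).congr (.of_forall fun t => ?_)
  simp only [Pi.add_apply]
  ring

lemma continuous_gaussian {D : ℕ} (ε : ℝ) (Γ : Matrix (Fin D) (Fin D) ℝ)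
    (z : (Fin D → ℝ) × (Fin D → ℝ)) : Continuous (gaussian ε Γ z) := by
  unfold gaussian
  fun_prop

lemma norm_gaussian {D : ℕ} (ε : ℝ) (Γ : Matrix (Fin D) (Fin D) ℝ)
    (z : (Fin D → ℝ) × (Fin D → ℝ)) (x : Fin D → ℝ) :
    ‖gaussian ε Γ z x‖ = |(Γ.det / (Real.pi ^ D * ε ^ D)) ^ ((1 : ℝ) / 4)| *
      Real.exp (-(1 / (2 * ε)) * ((x - z.1) ⬝ᵥ Γ.mulVec (x - z.1))) := by
  rw [gaussian, norm_mul, Complex.norm_real, Real.norm_eq_abs, Complex.norm_exp, Complex.add_re,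
    Complex.ofReal_re, Complex.re_mul_ofReal]
  simp

lemma norm_gaussian_le_const {D : ℕ} {ε : ℝ} (hε : 0 < ε) {Γ : Matrix (Fin D) (Fin D) ℝ}
    (hΓ : Γ.PosDef) (z : (Fin D → ℝ) × (Fin D → ℝ)) (x : Fin D → ℝ) :
    ‖gaussian ε Γ z x‖ ≤ |(Γ.det / (Real.pi ^ D * ε ^ D)) ^ ((1 : ℝ) / 4)| := by
  rw [norm_gaussian]
  refine mul_le_of_le_one_right (abs_nonneg _) (Real.exp_le_one_iff.2 ?_)
  have h := hΓ.posSemidef.dotProduct_mulVec_nonneg (x - z.1)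
  rw [star_trivial] at h
  rw [neg_mul, neg_nonpos]
  positivity

lemma norm_gaussian_le_prod {D : ℕ} (hD : 1 ≤ D) {ε : ℝ} (hε : 0 < ε)
    {Γ : Matrix (Fin D) (Fin D) ℝ} (hΓ : Γ.PosDef) (z : (Fin D → ℝ) × (Fin D → ℝ))
    (x : Fin D → ℝ) :
    ‖gaussian ε Γ z x‖ ≤ |(Γ.det / (Real.pi ^ D * ε ^ D)) ^ ((1 : ℝ) / 4)| *
      ∏ i, Real.exp (-(1 / (2 * ε * D * Γ⁻¹ i i)) * (x i - z.1 i) ^ 2) := by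
  have hD' : (0 : ℝ) < D := by exact_mod_cast hD
  rw [norm_gaussian, ← Real.exp_sum]
  gcongr
  have h := mul_le_mul_of_nonneg_left (sum_sq_div_inv_diag_le hΓ (x - z.1))
    (show 0 ≤ 1 / (2 * ε * D) by positivity)
  have hl : ∑ i, -(1 / (2 * ε * D * Γ⁻¹ i i)) * (x i - z.1 i) ^ 2
      = -(1 / (2 * ε * D) * ∑ i, (x - z.1) i ^ 2 / Γ⁻¹ i i) := by
    rw [Finset.mul_sum, ← Finset.sum_neg_distrib]
    refine Finset.sum_congr rfl fun i _ => ?_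
    have : Γ⁻¹ i i ≠ 0 := hΓ.inv.diag_pos.ne'
    simp only [Pi.sub_apply]
    field_simp
  have hr : 1 / (2 * ε * D) * (D * ((x - z.1) ⬝ᵥ Γ.mulVec (x - z.1)))
      = 1 / (2 * ε) * ((x - z.1) ⬝ᵥ Γ.mulVec (x - z.1)) := by
    field_simp
  rw [hl]
  linarith

lemma pow_le_prod_one_add_sq {ι : Type*} [Fintype ι] (x : ι → ℝ) (j : ι) {k : ℕ} (hk : k ≤ 2) :
    |x j| ^ k ≤ ∏ i, (1 + x i ^ 2) := by
  have h1 : |x j| ^ k ≤ 1 + x j ^ 2 := by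
    rw [← sq_abs (x j)]
    interval_cases k <;> nlinarith [sq_nonneg (|x j|), sq_nonneg (|x j| - 1)]
  classical
  refine h1.trans ?_
  rw [← Finset.mul_prod_erase Finset.univ (fun i => 1 + x i ^ 2) (Finset.mem_univ j)]
  exact le_mul_of_one_le_right (by positivity)
    (Finset.one_le_prod fun i _ => le_add_of_nonneg_right (sq_nonneg (x i)))

lemma integrable_conj_gaussian_mul_pow_mul_gaussian {D : ℕ} {ε : ℝ} (hε : 0 < ε)
    {Γ : Matrix (Fin D) (Fin D) ℝ} (hΓ : Γ.PosDef) (j : Fin D)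
    (y z : (Fin D → ℝ) × (Fin D → ℝ)) {k : ℕ} (hk : k ≤ 2) :
    Integrable fun x : Fin D → ℝ =>
      (starRingEnd ℂ) (gaussian ε Γ y x) * (x j : ℂ) ^ k * gaussian ε Γ z x := by
  have hD : 1 ≤ D := j.pos
  have hD' : (0 : ℝ) < D := by exact_mod_cast hD
  set c := |(Γ.det / (Real.pi ^ D * ε ^ D)) ^ ((1 : ℝ) / 4)|
  have hprod : Integrable fun x : Fin D → ℝ =>
      ∏ i, (1 + x i ^ 2) * Real.exp (-(1 / (2 * ε * D * Γ⁻¹ i i)) * (x i - z.1 i) ^ 2) := by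
    refine Integrable.fintype_prod (f := fun i (t : ℝ) =>
      (1 + t ^ 2) * Real.exp (-(1 / (2 * ε * D * Γ⁻¹ i i)) * (t - z.1 i) ^ 2)) fun i => ?_
    have : 0 < Γ⁻¹ i i := hΓ.inv.diag_pos
    exact integrable_one_add_sq_mul_exp_neg_mul_sub_sq (by positivity) _
  refine (hprod.const_mul (c * c)).mono' ?_ (.of_forall fun x => ?_)
  · have := continuous_gaussian ε Γ y
    have := continuous_gaussian ε Γ z
    have := Complex.continuous_conj
    exact Continuous.aestronglyMeasurable (by fun_prop)
  · rw [norm_mul, norm_mul, norm_pow, Complex.norm_real, Real.norm_eq_abs, RCLike.norm_conj,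
      Finset.prod_mul_distrib]
    calc ‖gaussian ε Γ y x‖ * |x j| ^ k * ‖gaussian ε Γ z x‖
        ≤ c * (∏ i, (1 + x i ^ 2)) *
          (c * ∏ i, Real.exp (-(1 / (2 * ε * D * Γ⁻¹ i i)) * (x i - z.1 i) ^ 2)) := by
          gcongr
          · exact norm_gaussian_le_const hε hΓ y x
          · exact pow_le_prod_one_add_sq x j hk
          · exact norm_gaussian_le_prod hD hε hΓ z x
      _ = _ := by ring

lemma hasLineDerivAt_gaussian {D : ℕ} (ε : ℝ) {Γ : Matrix (Fin D) (Fin D) ℝ}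
    (hΓ : Γ.PosDef) (j : Fin D) (z : (Fin D → ℝ) × (Fin D → ℝ)) (x : Fin D → ℝ) :
    HasLineDerivAt ℝ (gaussian ε Γ z)
      (gaussian ε Γ z x * ((-(1 / ε) * (x j - z.1 j) : ℝ) +
        Complex.I * ((1 / ε * Γ⁻¹.mulVec z.2 j : ℝ) : ℂ))) x (Γ⁻¹.col j) := by
  have hsymm : Γ⁻¹ᵀ = Γ⁻¹ := by simpa using hΓ.inv.isHermitian.eq
  have hp : z.2 ⬝ᵥ Γ⁻¹.col j = Γ⁻¹.mulVec z.2 j := by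
    rw [← mulVec_single_one, dotProduct_mulVec, ← mulVec_transpose, hsymm, dotProduct_single_one]
  have hA : HasDerivAt (fun t : ℝ => -(1 / (2 * ε)) *
      ((x + t • Γ⁻¹.col j - z.1) ⬝ᵥ Γ.mulVec (x + t • Γ⁻¹.col j - z.1)))
      (-(1 / ε) * (x j - z.1 j)) 0 := by
    simp only [add_sub_right_comm x, quadraticForm_add_smul_inv_col hΓ]
    have h := (((((hasDerivAt_id (0 : ℝ)).const_mul 2).mul_const ((x - z.1) j)).const_add
      ((x - z.1) ⬝ᵥ Γ.mulVec (x - z.1))).add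
      (((hasDerivAt_id (0 : ℝ)).pow 2).mul_const (Γ⁻¹ j j))).const_mul (-(1 / (2 * ε)))
    refine h.congr_deriv ?_
    simp
    ring
  have hB : HasDerivAt (fun t : ℝ => 1 / ε * (z.2 ⬝ᵥ (x + t • Γ⁻¹.col j - z.1)))
      (1 / ε * Γ⁻¹.mulVec z.2 j) 0 := by
    simp only [add_sub_right_comm x, dotProduct_add, dotProduct_smul, hp, smul_eq_mul]
    simpa using (((hasDerivAt_id (0 : ℝ)).mul_const (Γ⁻¹.mulVec z.2 j)).const_add
      (z.2 ⬝ᵥ (x - z.1))).const_mul (1 / ε)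
  have h := ((hA.ofReal_comp.add (hB.ofReal_comp.const_mul Complex.I)).cexp).const_mul
    (((Γ.det / (Real.pi ^ D * ε ^ D)) ^ ((1 : ℝ) / 4) : ℝ) : ℂ)
  unfold HasLineDerivAt
  refine h.congr_deriv ?_
  simp only [gaussian, Pi.add_apply, zero_smul, add_zero]
  ring

/-- The integral of a line derivative of an integrable function vanishes. -/
lemma integral_hasLineDerivAt_eq_zero {D : ℕ} {f f' : (Fin D → ℝ) → ℂ} {v : Fin D → ℝ}
    (hf' : Integrable f') (hf : Integrable f) (h : ∀ x, HasLineDerivAt ℝ f (f' x) x v) :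
    ∫ x, f' x = 0 := by
  have := integral_bilinear_hasLineDerivAt_right_eq_neg_left_of_integrable
    (μ := (volume : Measure (Fin D → ℝ))) (f := f) (f' := f') (g := fun _ => (1 : ℂ))
    (g' := fun _ => 0) (v := v) (B := ContinuousLinearMap.mul ℝ ℂ)
    (by simpa using hf') (by simp) (by simpa using hf) (fun x _ => h x)
    (fun x _ => hasDerivAt_const _ _)
  simpa using this.symm

theorem stmt11 (D : ℕ) (hD : 1 ≤ D) (ε : ℝ) (hε : 0 < ε)
    (Γ : Matrix (Fin D) (Fin D) ℝ) (hΓ : Γ.PosDef) (j : Fin D)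
    (y z : (Fin D → ℝ) × (Fin D → ℝ)) :
    Integrable (fun x : Fin D → ℝ =>
      (starRingEnd ℂ) (gaussian ε Γ y x) * (x j : ℂ) ^ 2 * gaussian ε Γ z x) ∧
    (∫ x : Fin D → ℝ,
        (starRingEnd ℂ) (gaussian ε Γ y x) * (x j : ℂ) ^ 2 * gaussian ε Γ z x) =
      (1 / 4) * (((2 * ε * Γ⁻¹ j j : ℝ) : ℂ) +
          (((y.1 j + z.1 j : ℝ) : ℂ) +
            Complex.I * ((Γ⁻¹.mulVec (z.2 - y.2) j : ℝ) : ℂ)) ^ 2) *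
        ∫ x : Fin D → ℝ, (starRingEnd ℂ) (gaussian ε Γ y x) * gaussian ε Γ z x := by
  have I0 : Integrable fun x : Fin D → ℝ =>
      (starRingEnd ℂ) (gaussian ε Γ y x) * gaussian ε Γ z x := by
    simpa using integrable_conj_gaussian_mul_pow_mul_gaussian hε hΓ j y z (k := 0) (by norm_num)
  have I1 : Integrable fun x : Fin D → ℝ =>
      (starRingEnd ℂ) (gaussian ε Γ y x) * (x j : ℂ) * gaussian ε Γ z x := by
    simpa using integrable_conj_gaussian_mul_pow_mul_gaussian hε hΓ j y z (k := 1) (by norm_num)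
  have I2 := integrable_conj_gaussian_mul_pow_mul_gaussian hε hΓ j y z (k := 2) le_rfl
  refine ⟨I2, ?_⟩
  set m : ℂ := ((y.1 j + z.1 j : ℝ) : ℂ) + Complex.I * ((Γ⁻¹.mulVec (z.2 - y.2) j : ℝ) : ℂ)
    with hm
  have hε' : (ε : ℂ) ≠ 0 := by exact_mod_cast hε.ne'
  have hf : Integrable fun x : Fin D → ℝ => (2 * (x j : ℂ) + m) *
      ((starRingEnd ℂ) (gaussian ε Γ y x) * gaussian ε Γ z x) :=
    ((I1.const_mul 2).add (I0.const_mul m)).congr (.of_forall fun x => by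
      simp only [Pi.add_apply]
      ring)
  have hf' : Integrable fun x : Fin D → ℝ =>
      (2 * (Γ⁻¹ j j : ℂ) + m ^ 2 / ε) *
        ((starRingEnd ℂ) (gaussian ε Γ y x) * gaussian ε Γ z x) -
      4 / ε * ((starRingEnd ℂ) (gaussian ε Γ y x) * (x j : ℂ) ^ 2 * gaussian ε Γ z x) :=
    (I0.const_mul _).sub (I2.const_mul _)
  have key := integral_hasLineDerivAt_eq_zero (v := Γ⁻¹.col j) hf' hf fun x => by
    have hy : HasDerivAt _ _ _ := hasLineDerivAt_gaussian ε hΓ j y x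
    have hz : HasDerivAt _ _ _ := hasLineDerivAt_gaussian ε hΓ j z x
    have hx : HasDerivAt (fun t : ℝ => (((x + t • Γ⁻¹.col j) j : ℝ) : ℂ)) (Γ⁻¹ j j : ℂ) 0 := by
      refine HasDerivAt.ofReal_comp ?_
      simpa using ((hasDerivAt_id (0 : ℝ)).mul_const (Γ⁻¹ j j)).const_add (x j)
    have h := ((hx.const_mul 2).add_const m).mul (hy.star.mul hz)
    unfold HasLineDerivAt
    refine h.congr_deriv ?_
    simp only [Pi.mul_apply, zero_smul, add_zero, hm, mulVec_sub, Pi.sub_apply,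
      ← starRingEnd_apply, map_mul, map_add, Complex.conj_ofReal, Complex.conj_I]
    push_cast
    field_simp
    ring
  rw [integral_sub (I0.const_mul _) (I2.const_mul _), integral_const_mul, integral_const_mul,
    sub_eq_zero] at key
  have h4 := congrArg (fun w : ℂ => ε / 4 * w) key
  field_simp at h4
  push_cast
  linear_combination (-1 / 4 : ℂ) * h4
end

section
/- (Variance of the sqrt-Husimi approach for the identity operator.) Let D ≥ 1, ε > 0, Γ ∈ ℝ^{D×D} real symmetric positive definite, z₀ ∈ ℝ^{2D}, and Σ₀ = diag(Γ, Γ⁻¹). Then: (i) the normalization constant of the square-root Husimi density of the Gaussian g_{z₀} satisfies κ := (2πε)^{-D} ∫_{ℝ^{2D}} |⟨g_{z₀}, g_ζ⟩| dζ = (2πε)^{-D} ∫_{ℝ^{2D}} exp(−(1/(4ε))(ζ−z₀)ᵀΣ₀(ζ−z₀)) dζ = 2^D; and (ii) 4^D (2πε)^{-2D} ∫_{ℝ^{2D}×ℝ^{2D}} |⟨g_{z₀}, g_y⟩| · |⟨g_z, g_{z₀}⟩| · |⟨g_y, g_z⟩|² d(y,z) = (16/5)^D, so that the initial-time variance of the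 sqrt-Husimi Monte Carlo estimator for the identity operator equals (16/5)^D − 1. -/
open MeasureTheory Matrix

/-- The `L²` overlap `⟨g_y , g_z⟩` of two Gaussian wavepackets. -/
noncomputable def overlap {D : ℕ} (ε : ℝ) (Γ : Matrix (Fin D) (Fin D) ℝ)
    (y z : (Fin D → ℝ) × (Fin D → ℝ)) : ℂ :=
  ∫ x : Fin D → ℝ, (starRingEnd ℂ) (gaussian ε Γ y x) * gaussian ε Γ z x

/-- The quadratic form `w ↦ wᵀ Σ₀ w` on the phase space, where
`Σ₀ = diag(Γ, Γ⁻¹)` is the block-diagonal matrix with blocks `Γ` and `Γ⁻¹`. -/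
noncomputable def quadSigma {D : ℕ} (Γ : Matrix (Fin D) (Fin D) ℝ)
    (w : (Fin D → ℝ) × (Fin D → ℝ)) : ℝ :=
  Sum.elim w.1 w.2 ⬝ᵥ (Matrix.fromBlocks Γ 0 0 Γ⁻¹).mulVec (Sum.elim w.1 w.2)

theorem Matrix.PosDef.exists_transpose_mul_mul_eq_one {ι : Type*} [Fintype ι] [DecidableEq ι]
    {M : Matrix ι ι ℝ} (hM : M.PosDef) :
    ∃ B : Matrix ι ι ℝ, B.det ≠ 0 ∧ Bᵀ * M * B = 1 ∧ B * Bᵀ = M⁻¹ ∧ |B.det| = √(M.det)⁻¹ := by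
  open scoped MatrixOrder in
  obtain ⟨S, hS⟩ := CStarAlgebra.nonneg_iff_eq_star_mul_self.mp hM.posSemidef.nonneg
  replace hS : M = Sᵀ * S := by simpa [star_eq_conjTranspose] using hS
  have hdet : S.det ≠ 0 := by
    intro h
    have := hM.det_pos
    simp [hS, h] at this
  have hu : IsUnit S.det := hdet.isUnit
  have hut : IsUnit Sᵀ.det := by simpa using hu
  refine ⟨S⁻¹, by simp [Matrix.det_nonsing_inv, hdet], ?_, ?_, ?_⟩
  · rw [hS, Matrix.transpose_nonsing_inv, ← Matrix.mul_assoc, Matrix.nonsing_inv_mul _ hut,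
      Matrix.one_mul, Matrix.mul_nonsing_inv _ hu]
  · rw [hS, Matrix.transpose_nonsing_inv, Matrix.mul_inv_rev]
  · rw [hS, Matrix.det_mul, Matrix.det_transpose, Matrix.det_nonsing_inv, Ring.inverse_eq_inv',
      mul_inv, Real.sqrt_mul_self_eq_abs]

theorem integral_comp_mulVec {ι E : Type*} [Fintype ι] [DecidableEq ι] [NormedAddCommGroup E]
    [NormedSpace ℝ E] {B : Matrix ι ι ℝ} (hB : B.det ≠ 0) (f : (ι → ℝ) → E) :
    ∫ x, f (B *ᵥ x) = |B.det|⁻¹ • ∫ x, f x := by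
  have hemb : MeasurableEmbedding (Matrix.toLin' B) :=
    (LinearEquiv.toContinuousLinearEquiv
      (Matrix.toLinearEquiv' B (B.invertibleOfIsUnitDet hB.isUnit))).toHomeomorph.measurableEmbedding
  have h := hemb.integral_map (μ := volume) f
  rw [Real.map_matrix_volume_pi_eq_smul_volume_pi hB, integral_smul_measure,
    ENNReal.toReal_ofReal (abs_nonneg _), abs_inv] at h
  simpa [Matrix.toLin'_apply] using h.symm

theorem integral_cexp_neg_quadraticForm_add {ι : Type*} [Fintype ι] [DecidableEq ι]
    {M : Matrix ι ι ℝ} (hM : M.PosDef) {b : ℝ} (hb : 0 < b) (c : ι → ℝ) :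
    ∫ x : ι → ℝ, Complex.exp (((-b * (x ⬝ᵥ M *ᵥ x) : ℝ) : ℂ) + Complex.I * ((c ⬝ᵥ x : ℝ) : ℂ)) =
      ((√((Real.pi / b) ^ Fintype.card ι * (M.det)⁻¹) *
        Real.exp (-(c ⬝ᵥ M⁻¹ *ᵥ c) / (4 * b)) : ℝ) : ℂ) := by
  obtain ⟨B, hB, hBM, hBB, hdet⟩ := hM.exists_transpose_mul_mul_eq_one
  have hpos : 0 < |B.det| := abs_pos.mpr hB
  have hcv := integral_comp_mulVec hB fun x : ι → ℝ =>
    Complex.exp (((-b * (x ⬝ᵥ M *ᵥ x) : ℝ) : ℂ) + Complex.I * ((c ⬝ᵥ x : ℝ) : ℂ))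
  have hq (x : ι → ℝ) : (B *ᵥ x) ⬝ᵥ M *ᵥ (B *ᵥ x) = x ⬝ᵥ x := by
    rw [← Matrix.vecMul_transpose B x, ← Matrix.dotProduct_mulVec, Matrix.vecMul_transpose,
      Matrix.mulVec_mulVec, Matrix.mulVec_mulVec, hBM, Matrix.one_mulVec]
  have hl (x : ι → ℝ) : c ⬝ᵥ B *ᵥ x = (c ᵥ* B) ⬝ᵥ x := Matrix.dotProduct_mulVec _ _ _
  have hc : (c ᵥ* B) ⬝ᵥ (c ᵥ* B) = c ⬝ᵥ M⁻¹ *ᵥ c := by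
    rw [← hBB, ← Matrix.mulVec_mulVec, Matrix.dotProduct_mulVec, Matrix.mulVec_transpose]
  have hint := GaussianFourier.integral_cexp_neg_mul_sum_add (b := (b : ℂ)) (by simpa using hb)
    fun i => Complex.I * (((c ᵥ* B) i : ℝ) : ℂ)
  have hpow : ((Real.pi : ℂ) / b) ^ (Fintype.card ι / 2 : ℂ) =
      ((√((Real.pi / b) ^ Fintype.card ι) : ℝ) : ℂ) := by
    rw [Real.sqrt_eq_rpow, ← Real.rpow_natCast, ← Real.rpow_mul (by positivity),
      Complex.ofReal_cpow (by positivity)]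
    push_cast
    ring_nf
  have hexp : (∑ i, (Complex.I * (((c ᵥ* B) i : ℝ) : ℂ)) ^ 2) / (4 * (b : ℂ)) =
      ((-(c ⬝ᵥ M⁻¹ *ᵥ c) / (4 * b) : ℝ) : ℂ) := by
    rw [← hc]
    simp [dotProduct, mul_pow, ← pow_two]
  rw [hpow, hexp] at hint
  have hcongr : (fun v : ι → ℝ => Complex.exp (-(b : ℂ) * ∑ i, (v i : ℂ) ^ 2 +
      ∑ i, Complex.I * (((c ᵥ* B) i : ℝ) : ℂ) * v i)) = fun v => Complex.exp
        (((-b * (v ⬝ᵥ v) : ℝ) : ℂ) + Complex.I * (((c ᵥ* B) ⬝ᵥ v : ℝ) : ℂ)) := by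
    ext v
    simp [dotProduct, Finset.mul_sum, pow_two, mul_assoc]
  simp only [hq, hl] at hcv
  rw [hcongr, hcv, Complex.real_smul] at hint
  rw [Real.sqrt_mul (by positivity), ← hdet]
  have hne : ((|B.det| : ℝ) : ℂ) ≠ 0 := by exact_mod_cast hpos.ne'
  push_cast at hint ⊢
  rw [inv_mul_eq_iff_eq_mul₀ hne] at hint
  rw [hint]
  ring

theorem integral_exp_neg_quadraticForm {ι : Type*} [Fintype ι] [DecidableEq ι]
    {M : Matrix ι ι ℝ} (hM : M.PosDef) {b : ℝ} (hb : 0 < b) :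
    ∫ x : ι → ℝ, Real.exp (-b * (x ⬝ᵥ M *ᵥ x)) =
      √((Real.pi / b) ^ Fintype.card ι * (M.det)⁻¹) := by
  have h := integral_cexp_neg_quadraticForm_add hM hb 0
  simp only [zero_dotProduct, Complex.ofReal_zero, mul_zero, add_zero, neg_zero, zero_div,
    Real.exp_zero, mul_one, ← Complex.ofReal_exp] at h
  rw [integral_complex_ofReal] at h
  exact_mod_cast h

theorem quadSigma_eq {D : ℕ} (Γ : Matrix (Fin D) (Fin D) ℝ) (w : (Fin D → ℝ) × (Fin D → ℝ)) :
    quadSigma Γ w = w.1 ⬝ᵥ Γ *ᵥ w.1 + w.2 ⬝ᵥ Γ⁻¹ *ᵥ w.2 := by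
  simp [quadSigma, Matrix.fromBlocks_mulVec]

theorem quadSigma_neg {D : ℕ} (Γ : Matrix (Fin D) (Fin D) ℝ) (w : (Fin D → ℝ) × (Fin D → ℝ)) :
    quadSigma Γ (-w) = quadSigma Γ w := by
  simp [quadSigma_eq, Matrix.mulVec_neg]

theorem quadSigma_sub_comm {D : ℕ} (Γ : Matrix (Fin D) (Fin D) ℝ)
    (y z : (Fin D → ℝ) × (Fin D → ℝ)) : quadSigma Γ (y - z) = quadSigma Γ (z - y) := by
  rw [← quadSigma_neg, neg_sub]

theorem continuous_quadSigma {D : ℕ} (Γ : Matrix (Fin D) (Fin D) ℝ) :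
    Continuous (quadSigma Γ) := by
  rw [funext (quadSigma_eq Γ)]
  fun_prop

theorem quadSigma_complete_square {D : ℕ} (Γ : Matrix (Fin D) (Fin D) ℝ)
    (y v : (Fin D → ℝ) × (Fin D → ℝ)) :
    quadSigma Γ y + quadSigma Γ (v + (2 / 3 : ℝ) • y) +
        2 * quadSigma Γ (y - (v + (2 / 3 : ℝ) • y)) =
      5 / 3 * quadSigma Γ y + 3 * quadSigma Γ v := by
  simp only [quadSigma_eq, Prod.fst_add, Prod.snd_add, Prod.fst_sub, Prod.snd_sub, Prod.smul_fst,
    Prod.smul_snd, Matrix.mulVec_add, Matrix.mulVec_sub, Matrix.mulVec_smul, dotProduct_add,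
    add_dotProduct, dotProduct_sub, sub_dotProduct, dotProduct_smul, smul_dotProduct, smul_eq_mul]
  ring

theorem integral_exp_neg_quadSigma {D : ℕ} {Γ : Matrix (Fin D) (Fin D) ℝ} (hΓ : Γ.PosDef)
    {b : ℝ} (hb : 0 < b) :
    ∫ w : (Fin D → ℝ) × (Fin D → ℝ), Real.exp (-b * quadSigma Γ w) = (Real.pi / b) ^ D := by
  simp only [quadSigma_eq, mul_add, Real.exp_add]
  rw [Measure.volume_eq_prod, integral_prod_mul (fun q => Real.exp (-b * (q ⬝ᵥ Γ *ᵥ q)))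
    fun p => Real.exp (-b * (p ⬝ᵥ Γ⁻¹ *ᵥ p)), integral_exp_neg_quadraticForm hΓ hb,
    integral_exp_neg_quadraticForm hΓ.inv hb, Fintype.card_fin]
  have hdet := hΓ.det_pos
  rw [← Real.sqrt_mul (by positivity), Matrix.det_nonsing_inv, Ring.inverse_eq_inv', inv_inv,
    Real.sqrt_eq_iff_mul_self_eq (by positivity) (by positivity)]
  field_simp

theorem norm_overlap {D : ℕ} {ε : ℝ} (hε : 0 < ε) {Γ : Matrix (Fin D) (Fin D) ℝ}
    (hΓ : Γ.PosDef) (y z : (Fin D → ℝ) × (Fin D → ℝ)) :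
    ‖overlap ε Γ y z‖ = Real.exp (-(1 / (4 * ε)) * quadSigma Γ (y - z)) := by
  have hdet := hΓ.det_pos
  set a : ℝ := Γ.det / (Real.pi ^ D * ε ^ D) with ha
  have hapos : 0 < a := by positivity
  set m : Fin D → ℝ := (1 / 2 : ℝ) • (y.1 + z.1) with hm
  set d : Fin D → ℝ := (1 / 2 : ℝ) • (y.1 - z.1) with hd
  set c : Fin D → ℝ := (1 / ε) • (z.2 - y.2) with hc
  set K : ℝ := √a * Real.exp (-(1 / ε) * (d ⬝ᵥ Γ *ᵥ d)) with hK
  set θ : ℝ := (1 / ε) * ((y.2 + z.2) ⬝ᵥ d) with hθ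
  have hprod (x : Fin D → ℝ) :
      (starRingEnd ℂ) (gaussian ε Γ y x) * gaussian ε Γ z x =
        ((K : ℂ) * Complex.exp (θ * Complex.I)) *
          Complex.exp (((-(1 / ε) * ((x - m) ⬝ᵥ Γ *ᵥ (x - m)) : ℝ) : ℂ) +
            Complex.I * ((c ⬝ᵥ (x - m) : ℝ) : ℂ)) := by
    have hy : x - y.1 = (x - m) - d := by
      ext i
      simp [hm, hd]
      ring
    have hz : x - z.1 = (x - m) + d := by
      ext i
      simp [hm, hd]
      ring
    have hsqrt : a ^ ((1 : ℝ) / 4) * a ^ ((1 : ℝ) / 4) = √a := by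
      rw [← Real.rpow_add hapos, Real.sqrt_eq_rpow]
      norm_num
    have hKc : (K : ℂ) = ((a ^ ((1 : ℝ) / 4) : ℝ) : ℂ) * ((a ^ ((1 : ℝ) / 4) : ℝ) : ℂ) *
        Complex.exp ((-(1 / ε) * (d ⬝ᵥ Γ *ᵥ d) : ℝ) : ℂ) := by
      rw [hK, ← hsqrt]
      push_cast
      rfl
    unfold gaussian
    rw [hy, hz, hKc, hθ, hc, ← ha]
    generalize x - m = t
    rw [map_mul, Complex.conj_ofReal, ← Complex.exp_conj, mul_mul_mul_comm, ← Complex.exp_add,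
      mul_assoc, mul_assoc, mul_assoc, ← Complex.exp_add, ← Complex.exp_add, ← mul_assoc]
    congr 2
    simp only [map_add, map_mul, Complex.conj_ofReal, Complex.conj_I, Matrix.mulVec_add,
      Matrix.mulVec_sub, dotProduct_add, add_dotProduct, dotProduct_sub, sub_dotProduct,
      smul_dotProduct, smul_eq_mul]
    push_cast
    ring
  have hint := integral_cexp_neg_quadraticForm_add hΓ (one_div_pos.mpr hε) c
  have hC : √a * √((Real.pi / (1 / ε)) ^ Fintype.card (Fin D) * (Γ.det)⁻¹) = 1 := by
    rw [← Real.sqrt_mul hapos.le, Real.sqrt_eq_one, ha, Fintype.card_fin]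
    field_simp
    rw [mul_pow]
  unfold overlap
  simp only [hprod]
  rw [integral_const_mul, integral_sub_right_eq_self (fun x : Fin D → ℝ =>
    Complex.exp (((-(1 / ε) * (x ⬝ᵥ Γ *ᵥ x) : ℝ) : ℂ) + Complex.I * ((c ⬝ᵥ x : ℝ) : ℂ))) m, hint,
    norm_mul, norm_mul, Complex.norm_exp_ofReal_mul_I, mul_one, Complex.norm_real,
    Complex.norm_real, Real.norm_of_nonneg (by positivity), Real.norm_of_nonneg (by positivity),
    hK, mul_mul_mul_comm, hC, one_mul, ← Real.exp_add]
  congr 1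
  rw [quadSigma_eq, hd, hc, Prod.fst_sub, Prod.snd_sub, ← neg_sub y.2 z.2]
  simp only [Matrix.mulVec_smul, dotProduct_smul, smul_dotProduct, smul_eq_mul, Matrix.mulVec_neg,
    dotProduct_neg, neg_dotProduct]
  field_simp
  ring

instance isAddRightInvariant_volume_phaseSpace (D : ℕ) :
    (volume : Measure ((Fin D → ℝ) × (Fin D → ℝ))).IsAddRightInvariant :=
  inferInstanceAs ((volume : Measure (Fin D → ℝ)).prod volume).IsAddRightInvariant

instance isAddRightInvariant_volume_phaseSpace_prod (D : ℕ) :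
    (volume : Measure
      (((Fin D → ℝ) × (Fin D → ℝ)) × ((Fin D → ℝ) × (Fin D → ℝ)))).IsAddRightInvariant :=
  Measure.prod.instIsAddRightInvariant (μ := (volume : Measure ((Fin D → ℝ) × (Fin D → ℝ))))
    (ν := (volume : Measure ((Fin D → ℝ) × (Fin D → ℝ))))

theorem measurePreserving_shear {E : Type*} [MeasurableSpace E] [NormedAddCommGroup E]
    [NormedSpace ℝ E] [BorelSpace E] [SecondCountableTopology E] (μ : Measure E) [SFinite μ]
    [μ.IsAddRightInvariant] (r : ℝ) :
    MeasurePreserving (fun w : E × E => (w.1, w.2 + r • w.1)) (μ.prod μ) (μ.prod μ) :=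
  (MeasurePreserving.id μ).skew_product (g := fun a x => x + r • a)
    (by unfold Function.uncurry; fun_prop)
    (.of_forall fun a => map_add_right_eq_self μ (r • a))

theorem integral_exp_neg_quadSigma_coupled {D : ℕ} {Γ : Matrix (Fin D) (Fin D) ℝ}
    (hΓ : Γ.PosDef) {b : ℝ} (hb : 0 < b) :
    ∫ w : ((Fin D → ℝ) × (Fin D → ℝ)) × ((Fin D → ℝ) × (Fin D → ℝ)),
        Real.exp (-b * (quadSigma Γ w.1 + quadSigma Γ w.2 + 2 * quadSigma Γ (w.1 - w.2))) =
      (Real.pi / (b * (5 / 3))) ^ D * (Real.pi / (b * 3)) ^ D := by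
  have hQ := continuous_quadSigma Γ
  have hT := measurePreserving_shear (volume : Measure ((Fin D → ℝ) × (Fin D → ℝ))) (2 / 3)
  rw [Measure.volume_eq_prod, ← hT.map_eq, integral_map hT.measurable.aemeasurable
    (Continuous.aestronglyMeasurable (by fun_prop))]
  have hsq (w : ((Fin D → ℝ) × (Fin D → ℝ)) × ((Fin D → ℝ) × (Fin D → ℝ))) :
      -b * (5 / 3 * quadSigma Γ w.1 + 3 * quadSigma Γ w.2) =
        -(b * (5 / 3)) * quadSigma Γ w.1 + -(b * 3) * quadSigma Γ w.2 := by ring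
  simp only [quadSigma_complete_square, hsq, Real.exp_add]
  rw [integral_prod_mul (fun y => Real.exp (-(b * (5 / 3)) * quadSigma Γ y))
    fun v => Real.exp (-(b * 3) * quadSigma Γ v), integral_exp_neg_quadSigma hΓ (by positivity),
    integral_exp_neg_quadSigma hΓ (by positivity)]

theorem stmt15 (D : ℕ) (hD : 1 ≤ D) (ε : ℝ) (hε : 0 < ε)
    (Γ : Matrix (Fin D) (Fin D) ℝ) (hΓ : Γ.PosDef)
    (z₀ : (Fin D → ℝ) × (Fin D → ℝ)) :
    -- (i) the normalization constant of the sqrt-Husimi density equals 2^D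
    (((2 * Real.pi * ε) ^ D)⁻¹ *
        (∫ ζ : (Fin D → ℝ) × (Fin D → ℝ), ‖overlap ε Γ z₀ ζ‖) =
      ((2 * Real.pi * ε) ^ D)⁻¹ *
        ∫ ζ : (Fin D → ℝ) × (Fin D → ℝ),
          Real.exp (-(1 / (4 * ε)) * quadSigma Γ (ζ - z₀)) ∧
     ((2 * Real.pi * ε) ^ D)⁻¹ *
        ∫ ζ : (Fin D → ℝ) × (Fin D → ℝ),
          Real.exp (-(1 / (4 * ε)) * quadSigma Γ (ζ - z₀)) = 2 ^ D) ∧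
    -- (ii) the second moment of the sqrt-Husimi Monte Carlo integrand and the variance
    (4 ^ D * (((2 * Real.pi * ε) ^ (2 * D))⁻¹) *
        (∫ w : ((Fin D → ℝ) × (Fin D → ℝ)) × ((Fin D → ℝ) × (Fin D → ℝ)),
          ‖overlap ε Γ z₀ w.1‖ * ‖overlap ε Γ w.2 z₀‖ * ‖overlap ε Γ w.1 w.2‖ ^ 2) =
      (16 / 5) ^ D ∧
     4 ^ D * (((2 * Real.pi * ε) ^ (2 * D))⁻¹) *
        (∫ w : ((Fin D → ℝ) × (Fin D → ℝ)) × ((Fin D → ℝ) × (Fin D → ℝ)),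
          ‖overlap ε Γ z₀ w.1‖ * ‖overlap ε Γ w.2 z₀‖ * ‖overlap ε Γ w.1 w.2‖ ^ 2) - 1 =
      (16 / 5) ^ D - 1) := by
  have hb : 0 < 1 / (4 * ε) := by positivity
  have hκ : ((2 * Real.pi * ε) ^ D)⁻¹ *
      ∫ ζ : (Fin D → ℝ) × (Fin D → ℝ),
        Real.exp (-(1 / (4 * ε)) * quadSigma Γ (ζ - z₀)) = 2 ^ D := by
    rw [integral_sub_right_eq_self (fun w => Real.exp (-(1 / (4 * ε)) * quadSigma Γ w)) z₀,
      integral_exp_neg_quadSigma hΓ hb, ← inv_pow, ← mul_pow]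
    congr 1
    field_simp
    norm_num
  have hm : 4 ^ D * (((2 * Real.pi * ε) ^ (2 * D))⁻¹) *
      (∫ w : ((Fin D → ℝ) × (Fin D → ℝ)) × ((Fin D → ℝ) × (Fin D → ℝ)),
        ‖overlap ε Γ z₀ w.1‖ * ‖overlap ε Γ w.2 z₀‖ * ‖overlap ε Γ w.1 w.2‖ ^ 2) =
      (16 / 5) ^ D := by
    have hF (w : ((Fin D → ℝ) × (Fin D → ℝ)) × ((Fin D → ℝ) × (Fin D → ℝ))) :
        ‖overlap ε Γ z₀ w.1‖ * ‖overlap ε Γ w.2 z₀‖ * ‖overlap ε Γ w.1 w.2‖ ^ 2 =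
          Real.exp (-(1 / (4 * ε)) * (quadSigma Γ (w - (z₀, z₀)).1 +
            quadSigma Γ (w - (z₀, z₀)).2 +
            2 * quadSigma Γ ((w - (z₀, z₀)).1 - (w - (z₀, z₀)).2))) := by
      rw [norm_overlap hε hΓ, norm_overlap hε hΓ, norm_overlap hε hΓ, quadSigma_sub_comm Γ z₀,
        ← Real.exp_nat_mul, ← Real.exp_add, ← Real.exp_add, Prod.fst_sub, Prod.snd_sub,
        sub_sub_sub_cancel_right]
      congr 1
      push_cast
      ring
    simp only [hF]
    rw [integral_sub_right_eq_self
      (fun w : ((Fin D → ℝ) × (Fin D → ℝ)) × ((Fin D → ℝ) × (Fin D → ℝ)) =>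
        Real.exp (-(1 / (4 * ε)) *
          (quadSigma Γ w.1 + quadSigma Γ w.2 + 2 * quadSigma Γ (w.1 - w.2)))) (z₀, z₀),
      integral_exp_neg_quadSigma_coupled hΓ hb, pow_mul, ← inv_pow, ← mul_pow, ← mul_pow,
      ← mul_pow]
    congr 1
    field_simp
    norm_num
  refine ⟨⟨?_, hκ⟩, hm, by rw [hm]⟩
  simp only [norm_overlap hε hΓ, quadSigma_sub_comm Γ z₀]
end

section
/- (Variance of the sqrt-Husimi approach for the position operator.) Let D ≥ 1, ε > 0, let Γ = diag(γ₁,…,γ_D) with all γ_j > 0, let z₀ = (q₀, p₀) ∈ ℝ^D × ℝ^D, Σ₀ = diag(Γ, Γ⁻¹), and fix j ∈ {1,…,D}. Then 4^D (2πε)^{-2D} ∫_{ℝ^{2D}×ℝ^{2D}} |⟨g_{z₀}, g_y⟩| · |⟨g_z, g_{z₀}⟩| · |∫_{ℝ^D} conj(g_y(x)) x_j g_z(x) dx|² d(y,z) = (1/4)(16/5)^D ( 4 q_{0,j}² + (24/5) ε γ_j^{-1} ), where q_{0,j} is the j-th component of q₀. Consequently, the initial-time variance of the sqrt-Husimi Monte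 Carlo estimator for the position operator q̂_j equals (1/4)(16/5)^D ( 4 q_{0,j}² + (24/5) ε γ_j^{-1} ) − q_{0,j}². -/
open MeasureTheory Matrix

open Complex in
theorem integral_mul_cexp_mul_cexp_neg_mul_sq {b : ℝ} (hb : 0 < b) (t : ℝ) :
    Integrable (fun x : ℝ => cexp (I * t * x) * cexp (-b * x ^ 2)) ∧
    Integrable (fun x : ℝ => (x : ℂ) * (cexp (I * t * x) * cexp (-b * x ^ 2))) ∧
    ∫ x : ℝ, (x : ℂ) * (cexp (I * t * x) * cexp (-b * x ^ 2)) =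
      I * t / (2 * b) * ∫ x : ℝ, cexp (I * t * x) * cexp (-b * x ^ 2) := by
  have hb' : 0 < (b : ℂ).re := by simpa using hb
  have hn : ∀ x : ℝ, ‖cexp (I * t * x)‖ = 1 := fun x => by
    rw [show I * t * x = ((t * x : ℝ) : ℂ) * I by push_cast; ring]
    exact norm_exp_ofReal_mul_I _
  have h0 : Integrable (fun x : ℝ => cexp (I * t * x) * cexp (-b * x ^ 2)) := by
    refine (integrable_cexp_neg_mul_sq hb').mono (by fun_prop) (.of_forall fun x => ?_)
    rw [norm_mul, hn, one_mul]
  have h1 : Integrable (fun x : ℝ => (x : ℂ) * (cexp (I * t * x) * cexp (-b * x ^ 2))) := by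
    refine (integrable_mul_cexp_neg_mul_sq hb').mono (by fun_prop) (.of_forall fun x => ?_)
    rw [norm_mul, norm_mul, hn, one_mul, norm_mul]
  refine ⟨h0, h1, ?_⟩
  have hd : ∀ x : ℝ, HasDerivAt (fun x : ℝ => cexp (I * t * x) * cexp (-b * x ^ 2))
      (I * t * (cexp (I * t * x) * cexp (-b * x ^ 2)) -
        2 * b * (x * (cexp (I * t * x) * cexp (-b * x ^ 2)))) x := fun x => by
    have e1 : HasDerivAt (fun x : ℝ => cexp (I * t * x)) (cexp (I * t * x) * (I * t)) x := by
      simpa using ((hasDerivAt_id x).ofReal_comp.const_mul (I * t)).cexp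
    have e2 : HasDerivAt (fun x : ℝ => cexp (-b * x ^ 2))
        (cexp (-b * x ^ 2) * (-b * (2 * x))) x := by
      simpa using (((hasDerivAt_id x).ofReal_comp.pow 2).const_mul (-b : ℂ)).cexp
    exact (e1.mul e2).congr_deriv (by ring)
  have := integral_eq_zero_of_hasDerivAt_of_integrable hd
    ((h0.const_mul _).sub (h1.const_mul _)) h0
  rw [integral_sub (h0.const_mul _) (h1.const_mul _), integral_const_mul,
    integral_const_mul, sub_eq_zero] at this
  have hb0 : (b : ℂ) ≠ 0 := by exact_mod_cast hb.ne'
  rw [div_mul_eq_mul_div, eq_div_iff (mul_ne_zero two_ne_zero hb0), this]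
  ring

theorem integral_quadratic_mul_exp_neg_mul_sq {b : ℝ} (hb : 0 < b) (A B C : ℝ) :
    Integrable (fun x : ℝ => (A + B * x + C * x ^ 2) * Real.exp (-b * x ^ 2)) ∧
    ∫ x : ℝ, (A + B * x + C * x ^ 2) * Real.exp (-b * x ^ 2) =
      (A + C / (2 * b)) * √(Real.pi / b) := by
  have h0 := integrable_exp_neg_mul_sq hb
  have h1 := integrable_mul_exp_neg_mul_sq hb
  have h2 : Integrable fun x : ℝ => x ^ 2 * Real.exp (-b * x ^ 2) := by
    simpa using integrable_rpow_mul_exp_neg_mul_sq hb (by norm_num : (-1 : ℝ) < 2)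
  have hd : ∀ x : ℝ, HasDerivAt (fun x : ℝ => Real.exp (-b * x ^ 2))
      (-(2 * b) * (x * Real.exp (-b * x ^ 2))) x := fun x => by
    have := ((hasDerivAt_pow 2 x).const_mul (-b)).exp
    exact this.congr_deriv (by push_cast; ring)
  have m1 : ∫ x : ℝ, x * Real.exp (-b * x ^ 2) = 0 := by
    have := integral_eq_zero_of_hasDerivAt_of_integrable hd (h1.const_mul _) h0
    rw [integral_const_mul] at this
    exact (mul_eq_zero.mp this).resolve_left (by linarith)
  have m2 : ∫ x : ℝ, x ^ 2 * Real.exp (-b * x ^ 2) = √(Real.pi / b) / (2 * b) := by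
    have hd2 : ∀ x : ℝ, HasDerivAt (fun x : ℝ => x * Real.exp (-b * x ^ 2))
        (Real.exp (-b * x ^ 2) - 2 * b * (x ^ 2 * Real.exp (-b * x ^ 2))) x := fun x =>
      ((hasDerivAt_id x).mul (hd x)).congr_deriv (by simp only [id]; ring)
    have := integral_eq_zero_of_hasDerivAt_of_integrable hd2 (h0.sub (h2.const_mul _)) h1
    rw [integral_sub h0 (h2.const_mul _), integral_const_mul, integral_gaussian] at this
    rw [eq_div_iff (by positivity)]
    linarith
  have e : (fun x : ℝ => (A + B * x + C * x ^ 2) * Real.exp (-b * x ^ 2)) = fun x =>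
      A * Real.exp (-b * x ^ 2) + B * (x * Real.exp (-b * x ^ 2)) +
        C * (x ^ 2 * Real.exp (-b * x ^ 2)) := by
    funext x; ring
  rw [e]
  have h01 : Integrable fun x : ℝ =>
      A * Real.exp (-b * x ^ 2) + B * (x * Real.exp (-b * x ^ 2)) :=
    (h0.const_mul A).add (h1.const_mul B)
  refine ⟨h01.add (h2.const_mul C), ?_⟩
  rw [integral_add h01 (h2.const_mul C), integral_add (h0.const_mul A) (h1.const_mul B),
    integral_const_mul, integral_const_mul, integral_const_mul, m1, m2, integral_gaussian]
  ring

/-- Integration in the coordinates `(a + b - 2q, a - b)`. -/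
theorem integral_comp_add_mul_comp_sub {F H : ℝ → ℝ} (hF : Integrable F) (hH : Integrable H)
    (q : ℝ) :
    Integrable (fun p : ℝ × ℝ => F (p.1 + p.2 - 2 * q) * H (p.1 - p.2)) ∧
    ∫ p : ℝ × ℝ, F (p.1 + p.2 - 2 * q) * H (p.1 - p.2) = 1 / 2 * ((∫ s, F s) * ∫ d, H d) := by
  let L : ℝ × ℝ →ₗ[ℝ] ℝ × ℝ :=
    Matrix.toLin (Module.Basis.finTwoProd ℝ) (Module.Basis.finTwoProd ℝ) !![1, 1; 1, -1]
  have hL : ∀ p, L p = (p.1 + p.2, p.1 - p.2) := fun p => by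
    simp [L, Matrix.toLin_finTwoProd_apply, sub_eq_add_neg]
  have hdet : LinearMap.det L = -2 := by
    simp only [L, LinearMap.det_toLin, Matrix.det_fin_two_of]; norm_num
  have hdet0 : LinearMap.det L ≠ 0 := by rw [hdet]; norm_num
  have hmap := Measure.map_linearMap_addHaar_eq_smul_addHaar (volume : Measure (ℝ × ℝ)) hdet0
  have hemb : MeasurableEmbedding L :=
    (LinearEquiv.ofIsUnitDet (f := L) (v := Module.Basis.finTwoProd ℝ)
      (v' := Module.Basis.finTwoProd ℝ) (by
        rw [LinearMap.det_toMatrix, hdet]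
        norm_num)).toContinuousLinearEquiv.toHomeomorph.measurableEmbedding
  have hFH : Integrable (fun p : ℝ × ℝ => F (p.1 - 2 * q) * H p.2) :=
    (hF.comp_sub_right (2 * q)).mul_prod hH
  have hcomp : (fun p : ℝ × ℝ => F (p.1 + p.2 - 2 * q) * H (p.1 - p.2)) =
      (fun p : ℝ × ℝ => F (p.1 - 2 * q) * H p.2) ∘ L := by
    funext p; simp [hL]
  constructor
  · rw [hcomp, ← hemb.integrable_map_iff, hmap]
    exact hFH.smul_measure ENNReal.ofReal_ne_top
  · have := hemb.integral_map (μ := volume) (fun p : ℝ × ℝ => F (p.1 - 2 * q) * H p.2)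
    rw [hmap, integral_smul_measure] at this
    simp only [hL] at this
    rw [← this, hdet, Measure.volume_eq_prod, integral_prod_mul (fun x => F (x - 2 * q)) H,
      integral_sub_right_eq_self F]
    rw [ENNReal.toReal_ofReal (abs_nonneg _), smul_eq_mul]
    norm_num [abs_of_neg]

theorem integral_pair_gaussian {c : ℝ} (hc : 0 < c) (q A B C E G : ℝ) :
    Integrable (fun p : ℝ × ℝ => (A + B * (p.1 + p.2 - 2 * q) + C * (p.1 + p.2 - 2 * q) ^ 2) *
      (E + G * (p.1 - p.2) ^ 2) *
      Real.exp (-c * ((p.1 - q) ^ 2 + (p.2 - q) ^ 2 + 2 * (p.1 - p.2) ^ 2))) ∧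
    ∫ p : ℝ × ℝ, (A + B * (p.1 + p.2 - 2 * q) + C * (p.1 + p.2 - 2 * q) ^ 2) *
      (E + G * (p.1 - p.2) ^ 2) *
      Real.exp (-c * ((p.1 - q) ^ 2 + (p.2 - q) ^ 2 + 2 * (p.1 - p.2) ^ 2)) =
      Real.pi / (√5 * c) * ((A + C / c) * (E + G / (5 * c))) := by
  obtain ⟨hF, hF'⟩ := integral_quadratic_mul_exp_neg_mul_sq (b := c / 2) (by positivity) A B C
  obtain ⟨hH, hH'⟩ :=
    integral_quadratic_mul_exp_neg_mul_sq (b := 5 * c / 2) (by positivity) E 0 G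
  obtain ⟨h1, h2⟩ := integral_comp_add_mul_comp_sub hF hH q
  have e : (fun p : ℝ × ℝ => (A + B * (p.1 + p.2 - 2 * q) + C * (p.1 + p.2 - 2 * q) ^ 2) *
      (E + G * (p.1 - p.2) ^ 2) *
      Real.exp (-c * ((p.1 - q) ^ 2 + (p.2 - q) ^ 2 + 2 * (p.1 - p.2) ^ 2))) = fun p =>
      (A + B * (p.1 + p.2 - 2 * q) + C * (p.1 + p.2 - 2 * q) ^ 2) *
          Real.exp (-(c / 2) * (p.1 + p.2 - 2 * q) ^ 2) *
        ((E + 0 * (p.1 - p.2) + G * (p.1 - p.2) ^ 2) *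
          Real.exp (-(5 * c / 2) * (p.1 - p.2) ^ 2)) := by
    funext p
    rw [show -c * ((p.1 - q) ^ 2 + (p.2 - q) ^ 2 + 2 * (p.1 - p.2) ^ 2) =
      -(c / 2) * (p.1 + p.2 - 2 * q) ^ 2 + -(5 * c / 2) * (p.1 - p.2) ^ 2 by ring, Real.exp_add]
    ring
  rw [e]
  refine ⟨h1, h2.trans ?_⟩
  have hs : √(Real.pi / (c / 2)) * √(Real.pi / (5 * c / 2)) = 2 * Real.pi / (√5 * c) := by
    rw [← Real.sqrt_mul (by positivity), show Real.pi / (c / 2) * (Real.pi / (5 * c / 2)) =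
      (2 * Real.pi / c) ^ 2 / 5 by field_simp, Real.sqrt_div (by positivity),
      Real.sqrt_sq (by positivity)]
    field_simp
  rw [hF', hH']
  calc _ = 1 / 2 * ((A + C / (2 * (c / 2))) * (E + G / (2 * (5 * c / 2)))) *
        (√(Real.pi / (c / 2)) * √(Real.pi / (5 * c / 2))) := by ring
    _ = _ := by rw [hs]; field_simp

theorem measurePreserving_prodProdProdComm :
    MeasurePreserving (fun w : (ℝ × ℝ) × (ℝ × ℝ) => ((w.1.1, w.2.1), (w.1.2, w.2.2))) := by
  have h1 := (volume_preserving_finTwoArrow (ℝ × ℝ)).symm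
  have h2 := volume_measurePreserving_arrowProdEquivProdArrow ℝ ℝ (Fin 2)
  have h3 := (volume_preserving_finTwoArrow ℝ).prod (volume_preserving_finTwoArrow ℝ)
  exact h3.comp (h2.comp h1)

theorem integral_position_mul_momentum {G K : ℝ × ℝ → ℝ} (hG : Integrable G)
    (hK : Integrable K) :
    Integrable (fun w : (ℝ × ℝ) × (ℝ × ℝ) => G (w.1.1, w.2.1) * K (w.1.2, w.2.2)) ∧
    ∫ w : (ℝ × ℝ) × (ℝ × ℝ), G (w.1.1, w.2.1) * K (w.1.2, w.2.2) =
      (∫ p, G p) * ∫ p, K p := by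
  have hm := measurePreserving_prodProdProdComm
  have he : MeasurableEmbedding
      (fun w : (ℝ × ℝ) × (ℝ × ℝ) => ((w.1.1, w.2.1), (w.1.2, w.2.2))) :=
    (Homeomorph.prodProdProdComm ℝ ℝ ℝ ℝ).measurableEmbedding
  refine ⟨(hm.integrable_comp_emb he).mpr (hG.mul_prod hK), ?_⟩
  rw [← integral_prod_mul G K]
  exact hm.integral_comp he (fun v : (ℝ × ℝ) × (ℝ × ℝ) => G v.1 * K v.2)

/-- The one-dimensional Gaussian wavepacket. -/
noncomputable def gaussianLine (ε γ : ℝ) (z : ℝ × ℝ) (x : ℝ) : ℂ :=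
  (((γ / (Real.pi * ε)) ^ ((1 : ℝ) / 4) : ℝ) : ℂ) *
    Complex.exp ((↑(-(1 / (2 * ε)) * ((x - z.1) * (γ * (x - z.1)))) : ℂ) +
      Complex.I * (↑((1 / ε) * (z.2 * (x - z.1))) : ℂ))

theorem gaussian_diagonal {D : ℕ} {ε : ℝ} (hε : 0 < ε) {γ : Fin D → ℝ} (hγ : ∀ k, 0 < γ k)
    (z : (Fin D → ℝ) × (Fin D → ℝ)) (x : Fin D → ℝ) :
    gaussian ε (Matrix.diagonal γ) z x = ∏ k, gaussianLine ε (γ k) (z.1 k, z.2 k) (x k) := by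
  unfold gaussian gaussianLine
  rw [Finset.prod_mul_distrib, ← Complex.exp_sum, ← Complex.ofReal_prod,
    Real.finsetProd_rpow _ _ (fun k _ => by have := hγ k; positivity)]
  congr 3
  · rw [Matrix.det_diagonal, Finset.prod_div_distrib]
    simp [mul_pow]
  · rw [Finset.sum_add_distrib, ← Finset.mul_sum, ← Complex.ofReal_sum, ← Complex.ofReal_sum,
      ← Finset.mul_sum, ← Finset.mul_sum]
    simp [dotProduct, Matrix.mulVec_diagonal]

/-- The modulus of the overlap of two one-dimensional Gaussian wavepackets. -/
noncomputable def overlapNorm (ε γ : ℝ) (y z : ℝ × ℝ) : ℝ :=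
  Real.exp (-(γ / (4 * ε)) * (y.1 - z.1) ^ 2 - (y.2 - z.2) ^ 2 / (4 * ε * γ))

section GaussianLine

open Complex

variable {ε γ : ℝ}

theorem conj_gaussianLine_mul (hε : 0 < ε) (hγ : 0 < γ) (y z : ℝ × ℝ) :
    ∃ θ : ℝ, ∀ x : ℝ,
      (starRingEnd ℂ) (gaussianLine ε γ y x) * gaussianLine ε γ z x =
      ((√(γ / (Real.pi * ε)) * Real.exp (-(γ / (4 * ε)) * (y.1 - z.1) ^ 2) : ℝ) : ℂ) *
        cexp (θ * I) *
        (cexp (I * ((z.2 - y.2) / ε : ℝ) * (x - (y.1 + z.1) / 2 : ℝ)) *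
          cexp (-(γ / ε : ℝ) * ((x - (y.1 + z.1) / 2 : ℝ) : ℂ) ^ 2)) := by
  refine ⟨(z.2 * ((y.1 + z.1) / 2 - z.1) - y.2 * ((y.1 + z.1) / 2 - y.1)) / ε, fun x => ?_⟩
  have hN : √(γ / (Real.pi * ε)) =
      (γ / (Real.pi * ε)) ^ ((1 : ℝ) / 4) * (γ / (Real.pi * ε)) ^ ((1 : ℝ) / 4) := by
    rw [← Real.rpow_add (by positivity), Real.sqrt_eq_rpow]; norm_num
  have hε0 : (ε : ℂ) ≠ 0 := by exact_mod_cast hε.ne'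
  unfold gaussianLine
  rw [map_mul, conj_ofReal, ← exp_conj, map_add, map_mul, conj_ofReal, conj_ofReal, conj_I, hN,
    ofReal_mul _ (Real.exp _), ofReal_mul _ (_ ^ ((1 : ℝ) / 4)), ofReal_exp]
  set N : ℂ := (((γ / (Real.pi * ε)) ^ ((1 : ℝ) / 4) : ℝ) : ℂ)
  rw [mul_mul_mul_comm, mul_assoc (N * N), mul_assoc (N * N), ← Complex.exp_add,
    ← Complex.exp_add, ← Complex.exp_add, ← Complex.exp_add]
  congr 2
  push_cast
  field_simp
  ring

theorem norm_integral_conj_gaussianLine_mul (hε : 0 < ε) (hγ : 0 < γ) (y z : ℝ × ℝ) :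
    ‖∫ x : ℝ, (starRingEnd ℂ) (gaussianLine ε γ y x) * gaussianLine ε γ z x‖ =
      overlapNorm ε γ y z := by
  obtain ⟨θ, h⟩ := conj_gaussianLine_mul hε hγ y z
  simp_rw [h]
  have hb : 0 < ((γ / ε : ℝ) : ℂ).re := by rw [ofReal_re]; positivity
  rw [integral_const_mul, integral_sub_right_eq_self (fun t : ℝ =>
    cexp (I * ((z.2 - y.2) / ε : ℝ) * t) * cexp (-(γ / ε : ℝ) * (t : ℂ) ^ 2)),
    fourierIntegral_gaussian hb]
  rw [norm_mul, norm_mul, norm_mul, norm_exp_ofReal_mul_I, norm_real]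
  have e1 : ‖((Real.pi : ℂ) / ((γ / ε : ℝ) : ℂ)) ^ (1 / 2 : ℂ)‖ = √(Real.pi / (γ / ε)) := by
    rw [← ofReal_div, norm_cpow_eq_rpow_re_of_pos (by positivity), Real.sqrt_eq_rpow]
    norm_num
  have e2 : ‖cexp (-(((z.2 - y.2) / ε : ℝ) : ℂ) ^ 2 / (4 * ((γ / ε : ℝ) : ℂ)))‖ =
      Real.exp (-(y.2 - z.2) ^ 2 / (4 * ε * γ)) := by
    rw [show -(((z.2 - y.2) / ε : ℝ) : ℂ) ^ 2 / (4 * ((γ / ε : ℝ) : ℂ)) =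
      ((-((z.2 - y.2) / ε) ^ 2 / (4 * (γ / ε)) : ℝ) : ℂ) by push_cast; ring, norm_exp_ofReal]
    congr 1
    field_simp
    ring
  have e3 : √(γ / (Real.pi * ε)) * √(Real.pi / (γ / ε)) = 1 := by
    rw [← Real.sqrt_mul (by positivity)]
    rw [Real.sqrt_eq_one]
    field_simp
  rw [e1, e2, Real.norm_of_nonneg (by positivity), overlapNorm,
    sub_eq_add_neg (-(γ / (4 * ε)) * _), Real.exp_add, neg_div]
  linear_combination (Real.exp (-(γ / (4 * ε)) * (y.1 - z.1) ^ 2) *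
    Real.exp (-((y.2 - z.2) ^ 2 / (4 * ε * γ)))) * e3

theorem norm_sq_integral_conj_gaussianLine_mul_id (hε : 0 < ε) (hγ : 0 < γ) (y z : ℝ × ℝ) :
    ‖∫ x : ℝ, (starRingEnd ℂ) (gaussianLine ε γ y x) * x * gaussianLine ε γ z x‖ ^ 2 =
      (((y.1 + z.1) / 2) ^ 2 + ((y.2 - z.2) / (2 * γ)) ^ 2) * overlapNorm ε γ y z ^ 2 := by
  have key : ∫ x : ℝ, (starRingEnd ℂ) (gaussianLine ε γ y x) * x * gaussianLine ε γ z x =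
      (((y.1 + z.1) / 2 : ℝ) + ((z.2 - y.2) / (2 * γ) : ℝ) * I) *
        ∫ x : ℝ, (starRingEnd ℂ) (gaussianLine ε γ y x) * gaussianLine ε γ z x := by
    obtain ⟨θ, h⟩ := conj_gaussianLine_mul hε hγ y z
    simp_rw [mul_right_comm _ _ (gaussianLine ε γ z _), h]
    obtain ⟨h0, h1, h2⟩ := integral_mul_cexp_mul_cexp_neg_mul_sq
      (b := γ / ε) (by positivity) ((z.2 - y.2) / ε)
    set K : ℝ → ℂ := fun t =>
      cexp (I * ((z.2 - y.2) / ε : ℝ) * t) * cexp (-(γ / ε : ℝ) * (t : ℂ) ^ 2) with hK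
    set N : ℂ := ((√(γ / (Real.pi * ε)) *
      Real.exp (-(γ / (4 * ε)) * (y.1 - z.1) ^ 2) : ℝ) : ℂ) * cexp (θ * I)
    set m : ℝ := (y.1 + z.1) / 2
    have e1 : ∀ x : ℝ, N * (cexp (I * ((z.2 - y.2) / ε : ℝ) * (x - m : ℝ)) *
        cexp (-(γ / ε : ℝ) * ((x - m : ℝ) : ℂ) ^ 2)) * x =
        (fun t : ℝ => N * (m * K t + t * K t)) (x - m) := fun x => by
      simp only [hK]; push_cast; ring
    have e2 : ∀ x : ℝ, N * (cexp (I * ((z.2 - y.2) / ε : ℝ) * (x - m : ℝ)) *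
        cexp (-(γ / ε : ℝ) * ((x - m : ℝ) : ℂ) ^ 2)) = (fun t : ℝ => N * K t) (x - m) :=
      fun x => rfl
    simp_rw [e1, e2]
    rw [integral_sub_right_eq_self (fun t : ℝ => N * (m * K t + t * K t)),
      integral_sub_right_eq_self (fun t : ℝ => N * K t), integral_const_mul,
      integral_const_mul, integral_add (h0.const_mul _) h1, integral_const_mul, h2]
    have hε0 : (ε : ℂ) ≠ 0 := by exact_mod_cast hε.ne'
    have hγ0 : (γ : ℂ) ≠ 0 := by exact_mod_cast hγ.ne'
    push_cast
    field_simp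
  rw [key, norm_mul, mul_pow, norm_integral_conj_gaussianLine_mul hε hγ, ← normSq_eq_norm_sq,
    normSq_add_mul_I]
  ring

/-- The exponential weight in the one-dimensional variance integral splits into a position and
a momentum factor. -/
theorem overlapNorm_mul (ε γ : ℝ) (u y z : ℝ × ℝ) :
    overlapNorm ε γ u y * overlapNorm ε γ z u * overlapNorm ε γ y z ^ 2 =
      Real.exp (-(γ / (4 * ε)) * ((y.1 - u.1) ^ 2 + (z.1 - u.1) ^ 2 + 2 * (y.1 - z.1) ^ 2)) *
      Real.exp (-(1 / (4 * ε * γ)) *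
        ((y.2 - u.2) ^ 2 + (z.2 - u.2) ^ 2 + 2 * (y.2 - z.2) ^ 2)) := by
  unfold overlapNorm
  rw [← Real.exp_nat_mul, ← Real.exp_add, ← Real.exp_add, ← Real.exp_add]
  congr 1
  push_cast
  ring

theorem integral_overlapNorm_mul (hε : 0 < ε) (hγ : 0 < γ) (u : ℝ × ℝ) :
    ∫ w : (ℝ × ℝ) × (ℝ × ℝ), overlapNorm ε γ u w.1 * overlapNorm ε γ w.2 u *
      overlapNorm ε γ w.1 w.2 ^ 2 = (2 * Real.pi * ε) ^ 2 * (4 / 5) := by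
  obtain ⟨hQ, hQ'⟩ := integral_pair_gaussian (c := γ / (4 * ε)) (by positivity) u.1 1 0 0 1 0
  obtain ⟨hP, hP'⟩ :=
    integral_pair_gaussian (c := 1 / (4 * ε * γ)) (by positivity) u.2 1 0 0 1 0
  have h := (integral_position_mul_momentum hQ hP).2
  rw [hQ', hP'] at h
  simp only [zero_mul, add_zero, one_mul] at h
  simp_rw [overlapNorm_mul, h]
  have h5 : √5 ^ 2 = (5 : ℝ) := Real.sq_sqrt (by norm_num)
  field_simp
  rw [h5]
  ring

theorem integral_sq_mean_mul_overlapNorm_mul (hε : 0 < ε) (hγ : 0 < γ) (u : ℝ × ℝ) :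
    ∫ w : (ℝ × ℝ) × (ℝ × ℝ), overlapNorm ε γ u w.1 * overlapNorm ε γ w.2 u *
      ((((w.1.1 + w.2.1) / 2) ^ 2 + ((w.1.2 - w.2.2) / (2 * γ)) ^ 2) *
        overlapNorm ε γ w.1 w.2 ^ 2) =
      (2 * Real.pi * ε) ^ 2 * (4 / 5) * (u.1 ^ 2 + 6 / 5 * ε * γ⁻¹) := by
  have hc : 0 < γ / (4 * ε) := by positivity
  have hd : 0 < 1 / (4 * ε * γ) := by positivity
  obtain ⟨hQ, hQ'⟩ := integral_pair_gaussian hc u.1 1 0 0 1 0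
  obtain ⟨hP, hP'⟩ := integral_pair_gaussian hd u.2 1 0 0 1 0
  obtain ⟨hQ₂, hQ₂'⟩ := integral_pair_gaussian hc u.1 (u.1 ^ 2) u.1 (1 / 4) 1 0
  obtain ⟨hP₂, hP₂'⟩ := integral_pair_gaussian hd u.2 1 0 0 0 (1 / (2 * γ) ^ 2)
  obtain ⟨i1, h1⟩ := integral_position_mul_momentum hQ₂ hP
  obtain ⟨i2, h2⟩ := integral_position_mul_momentum hQ hP₂
  rw [hQ₂', hP'] at h1
  rw [hQ', hP₂'] at h2
  have h := integral_add i1 i2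
  rw [h1, h2] at h
  have e : ∀ w : (ℝ × ℝ) × (ℝ × ℝ), overlapNorm ε γ u w.1 * overlapNorm ε γ w.2 u *
      ((((w.1.1 + w.2.1) / 2) ^ 2 + ((w.1.2 - w.2.2) / (2 * γ)) ^ 2) *
        overlapNorm ε γ w.1 w.2 ^ 2) =
      (((w.1.1 + w.2.1) / 2) ^ 2 + ((w.1.2 - w.2.2) / (2 * γ)) ^ 2) *
      (overlapNorm ε γ u w.1 * overlapNorm ε γ w.2 u * overlapNorm ε γ w.1 w.2 ^ 2) :=
    fun w => by ring
  simp_rw [e, overlapNorm_mul]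
  have h5 : √5 ^ 2 = (5 : ℝ) := Real.sq_sqrt (by norm_num)
  refine Eq.trans (integral_congr_ae (.of_forall fun w => ?_)) (h.trans ?_)
  · dsimp only
    ring
  · field_simp
    rw [h5]
    ring

end GaussianLine

theorem integral_prod_fin_phase_space {D : ℕ} (f : Fin D → (ℝ × ℝ) × (ℝ × ℝ) → ℝ) :
    ∫ w : ((Fin D → ℝ) × (Fin D → ℝ)) × ((Fin D → ℝ) × (Fin D → ℝ)),
      ∏ k, f k ((w.1.1 k, w.1.2 k), (w.2.1 k, w.2.2 k)) = ∏ k, ∫ v, f k v := by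
  let e := MeasurableEquiv.arrowProdEquivProdArrow ℝ ℝ (Fin D)
  have h1 := volume_measurePreserving_arrowProdEquivProdArrow ℝ ℝ (Fin D)
  have h2 := volume_measurePreserving_arrowProdEquivProdArrow (ℝ × ℝ) (ℝ × ℝ) (Fin D)
  have h3 : MeasurePreserving ((MeasurableEquiv.arrowProdEquivProdArrow (ℝ × ℝ) (ℝ × ℝ)
      (Fin D)).trans (e.prodCongr e)) := (h1.prod h1).comp h2
  rw [← integral_fintype_prod_volume_eq_prod, ← h3.integral_comp']
  rfl

theorem stmt17 (D : ℕ) (hD : 1 ≤ D) (ε : ℝ) (hε : 0 < ε)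
    (γ : Fin D → ℝ) (hγ : ∀ j, 0 < γ j)
    (z₀ : (Fin D → ℝ) × (Fin D → ℝ)) (j : Fin D) :
    4 ^ D * (((2 * Real.pi * ε) ^ (2 * D))⁻¹) *
        (∫ w : ((Fin D → ℝ) × (Fin D → ℝ)) × ((Fin D → ℝ) × (Fin D → ℝ)),
          ‖overlap ε (Matrix.diagonal γ) z₀ w.1‖ *
            ‖overlap ε (Matrix.diagonal γ) w.2 z₀‖ *
            ‖∫ x : Fin D → ℝ,
                (starRingEnd ℂ) (gaussian ε (Matrix.diagonal γ) w.1 x) * (x j : ℂ) *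
                  gaussian ε (Matrix.diagonal γ) w.2 x‖ ^ 2) =
      (1 / 4) * (16 / 5) ^ D * (4 * z₀.1 j ^ 2 + (24 / 5) * ε * (γ j)⁻¹) := by
  have hdiag := gaussian_diagonal hε hγ
  have hov : ∀ y z : (Fin D → ℝ) × (Fin D → ℝ), ‖overlap ε (Matrix.diagonal γ) y z‖ =
      ∏ k, overlapNorm ε (γ k) (y.1 k, y.2 k) (z.1 k, z.2 k) := fun y z => by
    simp_rw [overlap, hdiag, map_prod, ← Finset.prod_mul_distrib]
    rw [integral_fintype_prod_volume_eq_prod (fun k (x : ℝ) =>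
      (starRingEnd ℂ) (gaussianLine ε (γ k) (y.1 k, y.2 k) x) *
        gaussianLine ε (γ k) (z.1 k, z.2 k) x), norm_prod]
    simp_rw [norm_integral_conj_gaussianLine_mul hε (hγ _)]
  have hmom : ∀ y z : (Fin D → ℝ) × (Fin D → ℝ),
      ‖∫ x : Fin D → ℝ, (starRingEnd ℂ) (gaussian ε (Matrix.diagonal γ) y x) * (x j : ℂ) *
        gaussian ε (Matrix.diagonal γ) z x‖ ^ 2 =
      ∏ k, (if k = j then ((y.1 k + z.1 k) / 2) ^ 2 + ((y.2 k - z.2 k) / (2 * γ k)) ^ 2 else 1) *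
        overlapNorm ε (γ k) (y.1 k, y.2 k) (z.1 k, z.2 k) ^ 2 := fun y z => by
    have hx : ∀ x : Fin D → ℝ, (x j : ℂ) = ∏ k, if k = j then (x k : ℂ) else 1 := fun x => by
      simp
    simp_rw [hx, hdiag, map_prod, ← Finset.prod_mul_distrib]
    rw [integral_fintype_prod_volume_eq_prod (fun k (x : ℝ) =>
      (starRingEnd ℂ) (gaussianLine ε (γ k) (y.1 k, y.2 k) x) *
        (if k = j then (x : ℂ) else 1) * gaussianLine ε (γ k) (z.1 k, z.2 k) x), norm_prod,
      ← Finset.prod_pow]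
    refine Finset.prod_congr rfl fun k _ => ?_
    split_ifs
    · exact norm_sq_integral_conj_gaussianLine_mul_id hε (hγ k) _ _
    · simp only [mul_one, one_mul, norm_integral_conj_gaussianLine_mul hε (hγ k)]
  simp_rw [hov, hmom, ← Finset.prod_mul_distrib]
  rw [integral_prod_fin_phase_space (fun k v =>
    overlapNorm ε (γ k) (z₀.1 k, z₀.2 k) v.1 * overlapNorm ε (γ k) v.2 (z₀.1 k, z₀.2 k) *
      ((if k = j then ((v.1.1 + v.2.1) / 2) ^ 2 + ((v.1.2 - v.2.2) / (2 * γ k)) ^ 2 else 1) *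
        overlapNorm ε (γ k) v.1 v.2 ^ 2))]
  have hval : ∀ k, (∫ v : (ℝ × ℝ) × (ℝ × ℝ), overlapNorm ε (γ k) (z₀.1 k, z₀.2 k) v.1 *
      overlapNorm ε (γ k) v.2 (z₀.1 k, z₀.2 k) *
      ((if k = j then ((v.1.1 + v.2.1) / 2) ^ 2 + ((v.1.2 - v.2.2) / (2 * γ k)) ^ 2 else 1) *
        overlapNorm ε (γ k) v.1 v.2 ^ 2)) =
      (2 * Real.pi * ε) ^ 2 * (4 / 5) *
        if k = j then z₀.1 k ^ 2 + 6 / 5 * ε * (γ k)⁻¹ else 1 := fun k => by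
    split_ifs
    · exact integral_sq_mean_mul_overlapNorm_mul hε (hγ k) _
    · simp only [one_mul, mul_one, integral_overlapNorm_mul hε (hγ k)]
  simp_rw [hval]
  rw [Finset.prod_mul_distrib, Finset.prod_ite_eq' Finset.univ j, if_pos (Finset.mem_univ j),
    Finset.prod_const, Finset.card_univ, Fintype.card_fin, mul_pow _ (4 / 5 : ℝ), ← pow_mul,
    show (16 / 5 : ℝ) ^ D = 4 ^ D * (4 / 5) ^ D by rw [← mul_pow]; norm_num]
  have hne : (2 * Real.pi * ε) ^ (2 * D) ≠ 0 := by positivity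
  field_simp
  ring
end

section
/- (Diverging second moment of the importance sampling weight ρ_sqrt-H^dbl/ρ_opt.) Let D ≥ 1, ε > 0, Γ ∈ ℝ^{D×D} real symmetric positive definite, z₀ ∈ ℝ^{2D}, and Σ₀ = diag(Γ, Γ⁻¹). Define the densities ρ₁(y,z) = (4πε)^{-2D} exp( −(1/(4ε))[ (y−z₀)ᵀΣ₀(y−z₀) + (z−z₀)ᵀΣ₀(z−z₀) ] ) and ρ₂(y,z) = (3/4)^D (2πε)^{-2D} exp( −(1/(4ε))[ (y−z₀)ᵀΣ₀(y−z₀) + (z−z₀)ᵀΣ₀(z−z₀) + (y−z)ᵀΣ₀(y−z) ] ) on ℝ^{2D} × ℝ^{2D}. Then the function ρ₁²/ρ₂ is NOT Lebesgue integrable on ℝ^{2D} × ℝ^{2D}; equivalently, ∫_{ℝ^{2D}×ℝ^{2D}} exp( −(1/(2ε)) (y−z₀)ᵀ Σ₀ (z−z₀) ) d(y,z) = +∞. Hence the second moment of the weight W = ρ₁/ρ₂ under ρ₂ does not exist. -/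
open MeasureTheory Matrix

/-- The bilinear form `(u, v) ↦ uᵀ Σ₀ v` on the phase space, where
`Σ₀ = diag(Γ, Γ⁻¹)` is the block-diagonal matrix with blocks `Γ` and `Γ⁻¹`. -/
noncomputable def bilinSigma {D : ℕ} (Γ : Matrix (Fin D) (Fin D) ℝ)
    (u v : (Fin D → ℝ) × (Fin D → ℝ)) : ℝ :=
  Sum.elim u.1 u.2 ⬝ᵥ (Matrix.fromBlocks Γ 0 0 Γ⁻¹).mulVec (Sum.elim v.1 v.2)

theorem bilinSigma_eq {D : ℕ} (Γ : Matrix (Fin D) (Fin D) ℝ)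
    (u v : (Fin D → ℝ) × (Fin D → ℝ)) :
    bilinSigma Γ u v = u.1 ⬝ᵥ Γ *ᵥ v.1 + u.2 ⬝ᵥ Γ⁻¹ *ᵥ v.2 := by
  simp [bilinSigma, fromBlocks_mulVec, sumElim_dotProduct_sumElim]

theorem bilinSigma_neg_right {D : ℕ} (Γ : Matrix (Fin D) (Fin D) ℝ)
    (u v : (Fin D → ℝ) × (Fin D → ℝ)) : bilinSigma Γ u (-v) = -bilinSigma Γ u v := by
  simp only [bilinSigma_eq, Prod.fst_neg, Prod.snd_neg, mulVec_neg, dotProduct_neg]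
  ring

theorem bilinSigma_comm {D : ℕ} {Γ : Matrix (Fin D) (Fin D) ℝ} (hΓ : Γ.IsSymm)
    (u v : (Fin D → ℝ) × (Fin D → ℝ)) : bilinSigma Γ u v = bilinSigma Γ v u := by
  have key (A : Matrix (Fin D) (Fin D) ℝ) (hA : Aᵀ = A) (x y : Fin D → ℝ) :
      x ⬝ᵥ A *ᵥ y = y ⬝ᵥ A *ᵥ x := by
    rw [dotProduct_mulVec, ← mulVec_transpose, hA, dotProduct_comm]
  rw [bilinSigma_eq, bilinSigma_eq, key Γ hΓ,
    key Γ⁻¹ (by rw [transpose_nonsing_inv, hΓ.eq])]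

theorem bilinSigma_sub_self {D : ℕ} {Γ : Matrix (Fin D) (Fin D) ℝ} (hΓ : Γ.IsSymm)
    (u v : (Fin D → ℝ) × (Fin D → ℝ)) :
    bilinSigma Γ (u - v) (u - v) =
      bilinSigma Γ u u + bilinSigma Γ v v - 2 * bilinSigma Γ u v := by
  have h := bilinSigma_comm hΓ u v
  simp only [bilinSigma_eq, Prod.fst_sub, Prod.snd_sub, mulVec_sub, dotProduct_sub,
    sub_dotProduct] at h ⊢
  linarith

theorem continuous_bilinSigma {D : ℕ} (Γ : Matrix (Fin D) (Fin D) ℝ) :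
    Continuous fun w : ((Fin D → ℝ) × (Fin D → ℝ)) × ((Fin D → ℝ) × (Fin D → ℝ)) =>
      bilinSigma Γ w.1 w.2 := by
  simp only [bilinSigma_eq]
  fun_prop

/-- The exponential of a function that is odd under a measure-preserving map has infinite integral
over a space of infinite measure. -/
theorem lintegral_exp_eq_top_of_odd {α : Type*} [MeasurableSpace α] {μ : Measure α}
    (hμ : μ Set.univ = ⊤) {T : α → α} (hT : MeasurePreserving T μ μ) {q : α → ℝ}
    (hq : Measurable q) (hodd : ∀ x, q (T x) = -q x) :
    ∫⁻ x, ENNReal.ofReal (Real.exp (q x)) ∂μ = ⊤ := by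
  have hf : Measurable fun x => ENNReal.ofReal (Real.exp (q x)) := by fun_prop
  have hle : (⊤ : ENNReal) ≤ ∫⁻ x, ENNReal.ofReal (Real.exp (q x)) ∂μ +
      ∫⁻ x, ENNReal.ofReal (Real.exp (q x)) ∂μ := by
    calc (⊤ : ENNReal) = ∫⁻ _, 1 ∂μ := by rw [lintegral_one, hμ]
      _ ≤ ∫⁻ x, (ENNReal.ofReal (Real.exp (q x)) + ENNReal.ofReal (Real.exp (q (T x)))) ∂μ := by
        refine lintegral_mono fun x => ?_
        rw [← ENNReal.ofReal_add (Real.exp_pos _).le (Real.exp_pos _).le,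
          ENNReal.one_le_ofReal, hodd]
        linarith [Real.add_one_le_exp (q x), Real.add_one_le_exp (-q x)]
      _ = _ := by rw [lintegral_add_left hf, hT.lintegral_comp hf]
  simpa using hle

theorem lintegral_exp_bilinSigma_eq_top {D : ℕ} (hD : 1 ≤ D) (c : ℝ)
    (Γ : Matrix (Fin D) (Fin D) ℝ) (z₀ : (Fin D → ℝ) × (Fin D → ℝ)) :
    ∫⁻ w : ((Fin D → ℝ) × (Fin D → ℝ)) × ((Fin D → ℝ) × (Fin D → ℝ)),
      ENNReal.ofReal (Real.exp (c * bilinSigma Γ (w.1 - z₀) (w.2 - z₀))) = ⊤ := by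
  have : Nonempty (Fin D) := ⟨⟨0, hD⟩⟩
  have : NoncompactSpace (((Fin D → ℝ) × (Fin D → ℝ)) × ((Fin D → ℝ) × (Fin D → ℝ))) :=
    NormedSpace.noncompactSpace ℝ _
  have : (volume : Measure ((Fin D → ℝ) × (Fin D → ℝ))).IsAddHaarMeasure :=
    Measure.prod.instIsAddHaarMeasure _ _
  have : (volume : Measure (((Fin D → ℝ) × (Fin D → ℝ)) ×
      ((Fin D → ℝ) × (Fin D → ℝ)))).IsAddHaarMeasure :=
    Measure.prod.instIsAddHaarMeasure _ _
  have hvol : (volume : Measure (((Fin D → ℝ) × (Fin D → ℝ)) × ((Fin D → ℝ) × (Fin D → ℝ))))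
      Set.univ = ⊤ := measure_univ_of_isAddLeftInvariant _
  have hrefl : MeasurePreserving (fun z : (Fin D → ℝ) × (Fin D → ℝ) => z₀ + z₀ - z) :=
    (Measure.measurePreserving_sub_left volume (z₀.1 + z₀.1)).prod
      (Measure.measurePreserving_sub_left volume (z₀.2 + z₀.2))
  refine lintegral_exp_eq_top_of_odd hvol ((MeasurePreserving.id volume).prod hrefl) ?_ fun w => ?_
  · have h := (continuous_bilinSigma Γ).comp
      (f := fun w : ((Fin D → ℝ) × (Fin D → ℝ)) × ((Fin D → ℝ) × (Fin D → ℝ)) =>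
        (w.1 - z₀, w.2 - z₀)) (by fun_prop)
    exact (continuous_const.mul h).measurable
  · have h : z₀ + z₀ - w.2 - z₀ = -(w.2 - z₀) := by abel
    simp only [Prod.map_fst, Prod.map_snd, id_eq, h, bilinSigma_neg_right, mul_neg]

theorem stmt18 (D : ℕ) (hD : 1 ≤ D) (ε : ℝ) (hε : 0 < ε)
    (Γ : Matrix (Fin D) (Fin D) ℝ) (hΓ : Γ.PosDef)
    (z₀ : (Fin D → ℝ) × (Fin D → ℝ))
    -- the squared sqrt-Husimi density of `g_{z₀}` on the double phase space
    (ρ₁ : ((Fin D → ℝ) × (Fin D → ℝ)) × ((Fin D → ℝ) × (Fin D → ℝ)) → ℝ)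
    (hρ₁ : ρ₁ = fun w => ((4 * Real.pi * ε) ^ (2 * D))⁻¹ *
      Real.exp (-(1 / (4 * ε)) *
        (bilinSigma Γ (w.1 - z₀) (w.1 - z₀) + bilinSigma Γ (w.2 - z₀) (w.2 - z₀))))
    -- the optimal sampling density for the identity operator with initial state `g_{z₀}`
    (ρ₂ : ((Fin D → ℝ) × (Fin D → ℝ)) × ((Fin D → ℝ) × (Fin D → ℝ)) → ℝ)
    (hρ₂ : ρ₂ = fun w => (3 / 4) ^ D * ((2 * Real.pi * ε) ^ (2 * D))⁻¹ *
      Real.exp (-(1 / (4 * ε)) *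
        (bilinSigma Γ (w.1 - z₀) (w.1 - z₀) + bilinSigma Γ (w.2 - z₀) (w.2 - z₀) +
          bilinSigma Γ (w.1 - w.2) (w.1 - w.2)))) :
    ¬ Integrable (fun w => ρ₁ w ^ 2 / ρ₂ w) ∧
    (∫⁻ w : ((Fin D → ℝ) × (Fin D → ℝ)) × ((Fin D → ℝ) × (Fin D → ℝ)),
        ENNReal.ofReal
          (Real.exp (-(1 / (2 * ε)) * bilinSigma Γ (w.1 - z₀) (w.2 - z₀)))) = ⊤ := by
  have htop := lintegral_exp_bilinSigma_eq_top hD (-(1 / (2 * ε))) Γ z₀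
  refine ⟨fun hint => ?_, htop⟩
  have hsymm : Γ.IsSymm := by simpa using hΓ.isHermitian
  obtain ⟨C, hC, hw⟩ : ∃ C : ℝ, C ≠ 0 ∧ ∀ w, ρ₁ w ^ 2 / ρ₂ w =
      C * Real.exp (-(1 / (2 * ε)) * bilinSigma Γ (w.1 - z₀) (w.2 - z₀)) := by
    refine ⟨((4 * Real.pi * ε) ^ (2 * D))⁻¹ ^ 2 /
      ((3 / 4) ^ D * ((2 * Real.pi * ε) ^ (2 * D))⁻¹), by positivity, fun w => ?_⟩
    have hsub : w.1 - w.2 = (w.1 - z₀) - (w.2 - z₀) := by abel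
    simp only [hρ₁, hρ₂]
    rw [hsub, bilinSigma_sub_self hsymm (w.1 - z₀) (w.2 - z₀), mul_pow, mul_div_mul_comm, ← Real.exp_nat_mul,
      ← Real.exp_sub]
    congr 2
    field_simp
    push_cast
    ring
  simp only [hw] at hint
  rw [integrable_const_mul_iff hC.isUnit] at hint
  have hfin := (hasFiniteIntegral_iff_ofReal (ae_of_all _ fun _ => (Real.exp_pos _).le)).1 hint.2
  exact hfin.ne htop
end
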